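/- arXiv:math/0106016 — 3 statements merged into one kernel-verified Lean document; each statement's English description precedes it below -/
import Mathlib

section
/- Let K be a field of characteristic zero with algebraic closure K̄. Every abstract (not assumed continuous) group homomorphism ρ: GL_2(K) → GL_d(K̄) that is irreducible over K̄ is equivalent to a representation of the form [⊗_{s=1}^{r} (σ_{φ_s}^{(n_s)} ∘ φ_s)] ⊗ (f ∘ det), for some integer r ≥ 0, positive integers n_1, …, n_r with ∏_{s=1}^{r}(n_s + 1) = d, field homomorphisms φ_1, …, φ_r: K → K̄, and a homomorphism of multiplicative groups f: K^× → K̄^×, where det: GL_2(K) → K^× is the determinant. -/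
open Matrix MvPolynomial
open scoped TensorProduct

variable {R : Type*} [CommRing R]

/-- The `m`-th symmetric power of the standard representation of `2 × 2` matrices, realized
on the space of homogeneous polynomials of degree `m` in the two variables `X 0, X 1`:
a matrix `M` acts by the linear substitution `X i ↦ ∑ j, M j i • X j` (so that on the
degree-one part, in the basis `X 0, X 1`, the coordinate action is given by `M` itself).
A linear substitution of a homogeneous polynomial of degree `m` is again homogeneous of
degree `m`, so composing with `homogeneousComponent m` does not change the value and merely
serves to land in the homogeneous submodule. -/
noncomputable def symPow (m : ℕ) (M : Matrix (Fin 2) (Fin 2) R) :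
    homogeneousSubmodule (Fin 2) R m →ₗ[R] homogeneousSubmodule (Fin 2) R m :=
  LinearMap.codRestrict _
    ((homogeneousComponent m).comp
      ((MvPolynomial.aeval fun i : Fin 2 => ∑ j : Fin 2, C (M j i) * X j).toLinearMap.comp
        (Submodule.subtype _)))
    fun _ => (mem_homogeneousSubmodule _ _).2 (homogeneousComponent_isHomogeneous m _)


section nilexp
variable {F A : Type*} [Field F] [CharZero F] [Ring A] [Algebra F A]

/-- exponential of a nilpotent element -/
noncomputable def nexp (F : Type*) {A : Type*} [Field F] [Ring A] [Algebra F A] (a : A) : A :=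
  ∑ i ∈ Finset.range (nilpotencyClass a), ((i.factorial : F)⁻¹) • a ^ i

theorem nexp_eq_exp [Algebra ℚ A] (a : A) : nexp F a = IsNilpotent.exp a := by
  unfold nexp IsNilpotent.exp
  refine Finset.sum_congr rfl fun i _ => ?_
  let : Algebra ℚ F := DivisionRing.toRatAlgebra
  have h1 : (i.factorial : F) ≠ 0 := by exact_mod_cast i.factorial_ne_zero
  have h2 : (i.factorial : ℚ) ≠ 0 := by exact_mod_cast i.factorial_ne_zero
  have h3 : (i.factorial : F) • ((i.factorial : F)⁻¹ • a ^ i) =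
    (i.factorial : F) • ((i.factorial : ℚ)⁻¹ • a ^ i) := by
    rw [smul_inv_smul₀ h1, Nat.cast_smul_eq_nsmul, ← Nat.cast_smul_eq_nsmul ℚ, smul_inv_smul₀ h2]
  have h4 := congrArg (fun z => (i.factorial : F)⁻¹ • z) h3
  simpa only [inv_smul_smul₀ h1] using h4

variable (F A) in
/-- the rational structure -/
noncomputable abbrev ratAlg : Algebra ℚ A :=
  Algebra.compHom A (algebraMap ℚ F)

theorem nexp_eq_sum {a : A} {k : ℕ} (h : a ^ k = 0) :
    nexp F a = ∑ i ∈ Finset.range k, ((i.factorial : F)⁻¹) • a ^ i := by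
  have h₁ : ∑ i ∈ Finset.range k, ((i.factorial : F)⁻¹) • a ^ i =
      ∑ i ∈ Finset.range (nilpotencyClass a), ((i.factorial : F)⁻¹) • a ^ i := by
    symm
    apply Finset.sum_subset
    · intro i hi
      simp only [Finset.mem_range] at *
      exact lt_of_lt_of_le hi (csInf_le' h)
    · intro i _ hi
      simp only [Finset.mem_range, not_lt] at hi
      rw [pow_eq_zero_of_le hi (pow_nilpotencyClass ⟨k, h⟩), smul_zero]
  exact h₁.symm

theorem nexp_add {a b : A} (h₁ : Commute a b) (h₂ : IsNilpotent a) (h₃ : IsNilpotent b) :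
    nexp F (a + b) = nexp F a * nexp F b := by
  let := ratAlg F A
  simp only [nexp_eq_exp]
  exact IsNilpotent.exp_add_of_commute h₁ h₂ h₃

theorem nexp_zero : nexp F (0 : A) = 1 := by
  let := ratAlg F A
  simp only [nexp_eq_exp]
  exact IsNilpotent.exp_zero

theorem nexp_mul_neg {a : A} (h : IsNilpotent a) : nexp F a * nexp F (-a) = 1 := by
  rw [← nexp_add (Commute.neg_right (Commute.refl a)) h h.neg, add_neg_cancel, nexp_zero]

theorem nexp_neg_mul {a : A} (h : IsNilpotent a) : nexp F (-a) * nexp F a = 1 := by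
  rw [← nexp_add (Commute.neg_left (Commute.refl a)) h.neg h, neg_add_cancel, nexp_zero]

theorem nexp_map {B : Type*} [Ring B] [Algebra F B] (f : A →ₐ[F] B) {a : A} (h : IsNilpotent a) :
    f (nexp F a) = nexp F (f a) := by
  obtain ⟨k, hk⟩ := h
  rw [nexp_eq_sum hk, nexp_eq_sum (a := f a) (k := k) (by rw [← map_pow, hk, map_zero])]
  simp

theorem pow_conj {a g g' : A} (hg : g' * g = 1) (hg' : g * g' = 1) (i : ℕ) :
    (g * a * g') ^ i = g * a ^ i * g' := by
  induction i with
  | zero => simp [hg']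
  | succ i ih =>
    rw [pow_succ, ih, pow_succ]
    calc g * a ^ i * g' * (g * a * g') = g * a ^ i * (g' * g) * a * g' := by noncomm_ring
      _ = _ := by rw [hg]; noncomm_ring

theorem isNilpotent_conj {a g g' : A} (hg : g' * g = 1) (hg' : g * g' = 1) (h : IsNilpotent a) :
    IsNilpotent (g * a * g') := by
  obtain ⟨k, hk⟩ := h
  exact ⟨k, by rw [pow_conj hg hg', hk]; simp⟩

theorem nexp_conj {a g g' : A} (hg : g' * g = 1) (hg' : g * g' = 1) (h : IsNilpotent a) :
    nexp F (g * a * g') = g * nexp F a * g' := by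
  obtain ⟨k, hk⟩ := h
  rw [nexp_eq_sum hk, nexp_eq_sum (k := k) (by rw [pow_conj hg hg', hk]; simp)]
  simp only [pow_conj hg hg', Finset.mul_sum, Finset.sum_mul, mul_smul_comm, smul_mul_assoc]

theorem nexp_smul_eq_sum {a : A} {k : ℕ} (h : a ^ k = 0) (t : F) :
    nexp F (t • a) = ∑ i ∈ Finset.range k, t ^ i • ((i.factorial : F)⁻¹) • a ^ i := by
  rw [nexp_eq_sum (k := k) (by rw [smul_pow, h, smul_zero])]
  refine Finset.sum_congr rfl fun i _ => ?_
  rw [smul_pow, smul_comm]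

theorem isNilpotent_nexp_nsmul {a : A} (h : IsNilpotent a) (n : ℕ) :
    nexp F ((n : F) • a) = nexp F a ^ n := by
  induction n with
  | zero => simp [nexp_zero]
  | succ n ih =>
    rw [Nat.cast_succ, add_smul, one_smul, nexp_add _ (h.smul _) h, ih, pow_succ]
    exact (Commute.refl a).smul_left _

/-- A vector-valued polynomial vanishing at all positive integers vanishes. -/
theorem poly_zero {M : Type*} [AddCommGroup M] [Module F M] (n : ℕ) (c : ℕ → M)
    (h : ∀ m : ℕ, 0 < m → ∑ i ∈ Finset.range n, (m : F) ^ i • c i = 0) :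
    ∀ i < n, c i = 0 := by
  intro i hi
  rw [← Module.forall_dual_apply_eq_zero_iff F]
  intro f
  let p : Polynomial F := ∑ i ∈ Finset.range n, Polynomial.monomial i (f (c i))
  have hp : p = 0 := by
    apply Polynomial.eq_zero_of_infinite_isRoot
    refine Set.Infinite.mono (s := Set.range (fun m : ℕ => ((m + 1 : ℕ) : F))) ?_ ?_
    · rintro _ ⟨m, rfl⟩
      have := congrArg f (h (m + 1) (Nat.succ_pos m))
      simp only [map_sum, map_smul, map_zero, smul_eq_mul] at this
      simp only [Set.mem_ofPred_eq, Polynomial.IsRoot.def, p, Polynomial.eval_finsetSum,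
        Polynomial.eval_monomial]
      rw [← this]
      exact Finset.sum_congr rfl fun i _ => mul_comm _ _
    · apply Set.infinite_range_of_injective
      intro a b hab
      simpa using hab
  have h2 := congrArg (fun q => Polynomial.coeff q i) hp
  simpa [p, Polynomial.finsetSum_coeff, Polynomial.coeff_monomial, hi] using h2

theorem nexp_inj {a b : A} (ha : IsNilpotent a) (hb : IsNilpotent b)
    (h : nexp F a = nexp F b) : a = b := by
  obtain ⟨k, hk⟩ := id ha
  obtain ⟨l, hl⟩ := id hb
  have hk' : a ^ (k + l + 2) = 0 := by rw [show k + l + 2 = k + (l + 2) by ring, pow_add, hk, zero_mul]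
  have hl' : b ^ (k + l + 2) = 0 := by rw [show k + l + 2 = l + (k + 2) by ring, pow_add, hl, zero_mul]
  have := poly_zero (F := F) (k + l + 2)
    (fun i => ((i.factorial : F)⁻¹) • a ^ i - ((i.factorial : F)⁻¹) • b ^ i) (by
      intro m _
      have h1 := isNilpotent_nexp_nsmul (F := F) ha m
      rw [h, ← isNilpotent_nexp_nsmul (F := F) hb m, nexp_smul_eq_sum hk', nexp_smul_eq_sum hl'] at h1
      simp only [smul_sub, Finset.sum_sub_distrib]
      rw [h1, sub_self]) 1 (by omega)
  simpa [sub_eq_zero] using this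

theorem commute_of_commute_nexp {a b : A} (ha : IsNilpotent a)
    (h : ∀ m : ℕ, Commute (nexp F ((m : F) • a)) b) : Commute a b := by
  obtain ⟨k, hk⟩ := id ha
  have hk' : a ^ (k + 2) = 0 := by rw [pow_add, hk, zero_mul]
  have := poly_zero (F := F) (k + 2)
    (fun i => ((i.factorial : F)⁻¹) • a ^ i * b - b * ((i.factorial : F)⁻¹) • a ^ i) (by
      intro m _
      have h1 := (h m).eq
      rw [nexp_smul_eq_sum hk', Finset.sum_mul, Finset.mul_sum] at h1
      simp only [smul_mul_assoc, mul_smul_comm] at h1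
      simp only [smul_sub, Finset.sum_sub_distrib, smul_mul_assoc, mul_smul_comm]
      rw [h1, sub_self]) 1 (by omega)
  refine (?_ : a * b = b * a)
  simpa [sub_eq_zero] using this

theorem commute_nexp {a b : A} (ha : IsNilpotent a) (h : Commute a b) :
    Commute (nexp F a) b := by
  obtain ⟨k, hk⟩ := ha
  rw [nexp_eq_sum hk]
  exact Commute.sum_left _ _ _ fun i _ => (h.pow_left i).smul_left _

theorem exists_log_comm {S : Type*} [CommRing S] [Algebra F S] (a : S) (ha : IsNilpotent a)
    (k : ℕ) : ∃ b c : S, IsNilpotent b ∧ (1 + a) * nexp F (-b) = 1 + a ^ (k + 1) * c := by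
  induction k with
  | zero => exact ⟨0, 1, IsNilpotent.zero, by simp [nexp_zero]⟩
  | succ k ih =>
    obtain ⟨b, c, hb, h⟩ := ih
    set e := a ^ (k + 1) * c with he
    have hen : IsNilpotent e := (Commute.all _ _).isNilpotent_mul_right (ha.pow_of_pos (Nat.succ_ne_zero k))
    obtain ⟨q, hq⟩ : ∃ q, nexp F (-e) = 1 - e + e ^ 2 * q := by
      obtain ⟨n, hn⟩ := hen.neg
      rw [nexp_eq_sum (k := n + 2) (by rw [pow_add, hn, zero_mul]), Finset.sum_range_succ',
        Finset.sum_range_succ']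
      refine ⟨∑ i ∈ Finset.range n, (((i + 1 + 1).factorial : F)⁻¹) • (-e) ^ i, ?_⟩
      rw [Finset.mul_sum]
      have : ∀ i, e ^ 2 * (((i + 1 + 1).factorial : F)⁻¹ • (-e) ^ i) =
          ((i + 1 + 1).factorial : F)⁻¹ • (-e) ^ (i + 1 + 1) := by
        intro i
        rw [mul_smul_comm]; congr 1; ring
      simp only [this]
      simp
      ring
    refine ⟨b + e, a ^ k * c ^ 2 * (-1 + q * (1 + e)), (Commute.all _ _).isNilpotent_add hb hen, ?_⟩
    rw [neg_add, nexp_add (Commute.all _ _) hb.neg hen.neg, ← mul_assoc, h, hq, he]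
    ring

theorem exists_log (u : A) (hu : IsNilpotent (u - 1)) :
    ∃ b : A, IsNilpotent b ∧ nexp F b = u := by
  obtain ⟨n, hn⟩ := hu
  let S := AdjoinRoot ((Polynomial.X : Polynomial F) ^ n)
  let a : S := AdjoinRoot.root _
  have ha : a ^ n = 0 := by
    have := AdjoinRoot.eval₂_root ((Polynomial.X : Polynomial F) ^ n)
    simpa using this
  obtain ⟨b, c, hb, h⟩ := exists_log_comm (F := F) a ⟨n, ha⟩ n
  rw [pow_succ, ha] at h
  simp only [zero_mul, add_zero] at h
  have h2 : nexp F b = 1 + a := by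
    have := congrArg (· * nexp F b) h
    simp only [mul_assoc, nexp_neg_mul hb, one_mul, mul_one] at this
    exact this.symm
  let f : S →ₐ[F] A := Ideal.Quotient.liftₐ _ (Polynomial.aeval (u - 1)) (by
    intro p hp
    obtain ⟨q, rfl⟩ := Ideal.mem_span_singleton.1 hp
    simp [hn])
  have hf : f a = u - 1 := by
    change (Polynomial.aeval (u - 1)) Polynomial.X = _
    simp
  refine ⟨f b, hb.map f, ?_⟩
  rw [← nexp_map f hb, h2, map_add, map_one, hf]
  abel

end nilexp


section linalg
variable {F V : Type*} [Field F] [IsAlgClosed F] [AddCommGroup V] [Module F V] [FiniteDimensional F V]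

theorem isNilpotent_of_spectrum (f : Module.End F V) (h : ∀ μ ∈ spectrum F f, μ = 0) :
    IsNilpotent f := by
  have h1 := (IsAlgClosed.splits f.charpoly).eq_prod_roots_of_monic f.charpoly_monic
  have h2 : f.charpoly.roots = Multiset.replicate (Multiset.card f.charpoly.roots) 0 := by
    rw [Multiset.eq_replicate]
    refine ⟨rfl, fun b hb => h b ?_⟩
    rw [← Module.End.hasEigenvalue_iff_mem_spectrum, Module.End.hasEigenvalue_iff_isRoot_charpoly]
    exact Polynomial.isRoot_of_mem_roots hb
  rw [h2] at h1
  have h3 := f.aeval_self_charpoly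
  rw [h1] at h3
  simp at h3
  exact ⟨_, h3⟩

theorem spectrum_root_of_unity (f g g' : Module.End F V) (hg : g' * g = 1) (hg' : g * g' = 1)
    (hf : IsUnit f) (h : g * f * g' = f ^ 2) :
    ∀ μ ∈ spectrum F f, μ ^ (2 ^ Module.finrank F V).factorial = 1 := by
  classical
  intro μ hμ
  have hsq : ∀ ν ∈ spectrum F f, ν ^ 2 ∈ spectrum F f := by
    intro ν hν
    have h1 := spectrum.pow_mem_pow f 2 hν
    rw [← h] at h1
    let u : (Module.End F V)ˣ := ⟨g, g', hg', hg⟩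
    have := spectrum.units_conjugate (R := F) (a := f) (u := u)
    rw [← this]
    exact h1
  have hpow : ∀ i : ℕ, μ ^ (2 ^ i) ∈ spectrum F f := by
    intro i
    induction i with
    | zero => simpa using hμ
    | succ i ih => rw [pow_succ, pow_mul]; exact hsq _ ih
  have hmem : ∀ i : ℕ, μ ^ (2 ^ i) ∈ f.charpoly.roots.toFinset := by
    intro i
    have := hpow i
    rw [← Module.End.hasEigenvalue_iff_mem_spectrum, Module.End.hasEigenvalue_iff_isRoot_charpoly] at this
    rw [Multiset.mem_toFinset, Polynomial.mem_roots f.charpoly_monic.ne_zero]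
    exact this
  have hcard : f.charpoly.roots.toFinset.card ≤ Module.finrank F V := by
    refine (Multiset.toFinset_card_le _).trans ((Polynomial.card_roots' _).trans ?_)
    rw [LinearMap.charpoly_natDegree]
  obtain ⟨i, hi, j, hj, hij, he⟩ := Finset.exists_ne_map_eq_of_card_lt_of_maps_to
    (s := Finset.range (Module.finrank F V + 1)) (t := f.charpoly.roots.toFinset)
    (f := fun i => μ ^ (2 ^ i)) (by simpa using Nat.lt_succ_of_le hcard) (fun i _ => hmem i)
  have hμ0 : μ ≠ 0 := by
    rintro rfl
    exact spectrum.zero_notMem F hf hμ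
  wlog hlt : i < j generalizing i j
  · exact this j hj i hi hij.symm he.symm (by omega)
  simp only [Finset.mem_range] at hi hj
  have h2 : 2 ^ i < 2 ^ j := Nat.pow_lt_pow_right (by norm_num) hlt
  have h3 : μ ^ (2 ^ j - 2 ^ i) = 1 := by
    have : μ ^ (2 ^ i) * μ ^ (2 ^ j - 2 ^ i) = μ ^ (2 ^ i) * 1 := by
      rw [← pow_add, Nat.add_sub_cancel' h2.le, mul_one]; exact he.symm
    exact mul_left_cancel₀ (pow_ne_zero _ hμ0) this
  have h4 : 2 ^ j - 2 ^ i ∣ (2 ^ Module.finrank F V).factorial := by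
    apply Nat.dvd_factorial (by omega)
    have : 2 ^ j ≤ 2 ^ Module.finrank F V := Nat.pow_le_pow_right (by norm_num) (by omega)
    exact (Nat.sub_le _ _).trans this
  obtain ⟨q, hq⟩ := h4
  rw [hq, pow_mul, h3, one_pow]

theorem unipotent_of_conj (f g g' f0 : Module.End F V) (hg : g' * g = 1) (hg' : g * g' = 1)
    (hf : IsUnit f) (h : g * f * g' = f ^ 2)
    (h0 : f ^ (2 ^ Module.finrank F V).factorial = f0) : IsNilpotent (f0 - 1) := by
  apply isNilpotent_of_spectrum
  intro μ hμ
  have h1 : μ + 1 ∈ spectrum F f0 := by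
    have := spectrum.add_mem_iff (R := F) (a := f0 - 1) (r := μ + 1) (s := 1)
    rw [map_one] at this
    rw [spectrum.mem_iff] at hμ ⊢
    convert hμ using 2
    simp
    abel
  rw [← h0, spectrum.map_pow_of_pos _ (Nat.factorial_pos _)] at h1
  obtain ⟨ν, hν, he⟩ := h1
  have := spectrum_root_of_unity f g g' hg hg' hf h ν hν
  simp only [this] at he
  simpa using he.symm

theorem exists_common_eigenvector (S : Set (Module.End F V))
    (hS : ∀ f ∈ S, ∀ g ∈ S, Commute f g) (W₀ : Submodule F V) (hW₀ : W₀ ≠ ⊥)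
    (hst : ∀ f ∈ S, ∀ w ∈ W₀, f w ∈ W₀) :
    ∃ v ∈ W₀, v ≠ 0 ∧ ∀ f ∈ S, ∃ μ : F, f v = μ • v := by
  obtain ⟨W, ⟨hW1, hW2, hW3⟩, hmin⟩ := WellFounded.has_min
    (wellFounded_lt : WellFounded ((· < ·) : Submodule F V → Submodule F V → Prop))
    {W | W ≤ W₀ ∧ W ≠ ⊥ ∧ ∀ f ∈ S, ∀ w ∈ W, f w ∈ W} ⟨W₀, le_rfl, hW₀, hst⟩
  obtain ⟨v, hv, hv0⟩ := Submodule.exists_mem_ne_zero_of_ne_bot hW2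
  refine ⟨v, hW1 hv, hv0, fun f hf => ?_⟩
  have : Nontrivial W := Submodule.nontrivial_iff_ne_bot.2 hW2
  obtain ⟨μ, hμ⟩ := Module.End.exists_eigenvalue (f.restrict (hW3 f hf))
  obtain ⟨w, hw⟩ := hμ.exists_hasEigenvector
  refine ⟨μ, ?_⟩
  have hle : W ⊓ Module.End.eigenspace f μ = W := by
    by_contra hne
    refine hmin (W ⊓ Module.End.eigenspace f μ) ⟨inf_le_left.trans hW1, ?_, ?_⟩
      (lt_of_le_of_ne inf_le_left hne)
    · intro hbot
      have h1 : (w : V) ∈ W ⊓ Module.End.eigenspace f μ := by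
        refine ⟨w.2, ?_⟩
        have := hw.apply_eq_smul
        exact Module.End.mem_eigenspace_iff.2 (congrArg Subtype.val this)
      rw [hbot, Submodule.mem_bot] at h1
      exact hw.2 (Subtype.ext h1)
    · rintro g hg w ⟨hw1, hw2⟩
      refine ⟨hW3 g hg w hw1, ?_⟩
      change w ∈ Module.End.eigenspace f μ at hw2
      change g w ∈ Module.End.eigenspace f μ
      rw [Module.End.mem_eigenspace_iff] at hw2 ⊢
      have := congrArg (fun q : Module.End F V => q w) (hS f hf g hg).eq
      simp only [Module.End.mul_apply] at this
      rw [this, hw2, map_smul]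
  rw [← hle] at hv
  exact Module.End.mem_eigenspace_iff.1 hv.2

omit [IsAlgClosed F] [FiniteDimensional F V] in
theorem eigenvalue_zero_of_nilpotent (f : Module.End F V) (hf : IsNilpotent f) (v : V) (hv : v ≠ 0)
    (μ : F) (h : f v = μ • v) : μ = 0 := by
  have hp : ∀ n : ℕ, (f ^ n) v = μ ^ n • v := by
    intro n
    induction n with
    | zero => simp
    | succ n ih => rw [pow_succ', Module.End.mul_apply, ih, map_smul, h, smul_smul, pow_succ]
  obtain ⟨n, hn⟩ := hf
  have := hp n
  rw [hn, LinearMap.zero_apply] at this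
  have h2 : μ ^ n = 0 := (smul_eq_zero.1 this.symm).resolve_right hv
  exact eq_zero_of_pow_eq_zero h2

end linalg

section adj
variable {F A : Type*} [Field F] [CharZero F] [Ring A] [Algebra F A]

/-- the operator `a ↦ x a - a x` -/
noncomputable def adop (F : Type*) {A : Type*} [Field F] [Ring A] [Algebra F A] (x : A) : A →ₗ[F] A :=
  LinearMap.mulLeft F x - LinearMap.mulRight F x

omit [CharZero F] in
theorem adop_apply (x y : A) : adop F x y = x * y - y * x := rfl

omit [CharZero F] in
theorem commute_LR (a b : A) : Commute (LinearMap.mulLeft F a) (LinearMap.mulRight F b) := by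
  ext c
  exact (mul_assoc a c b).symm

theorem adop_nilpotent {x : A} (hx : IsNilpotent x) : IsNilpotent (adop F x) := by
  have h1 : IsNilpotent (LinearMap.mulLeft F x) := by
    obtain ⟨n, hn⟩ := hx; exact ⟨n, by rw [LinearMap.pow_mulLeft, hn]; ext; simp⟩
  have h2 : IsNilpotent (LinearMap.mulRight F x) := by
    obtain ⟨n, hn⟩ := hx; exact ⟨n, by rw [LinearMap.pow_mulRight, hn]; ext; simp⟩
  exact (commute_LR (F := F) x x).isNilpotent_sub h1 h2

theorem nexp_adop {x : A} (hx : IsNilpotent x) (y : A) :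
    nexp F (adop F x) y = nexp F x * y * nexp F (-x) := by
  obtain ⟨n, hn⟩ := id hx
  have h1 : IsNilpotent (LinearMap.mulLeft F x) := ⟨n, by rw [LinearMap.pow_mulLeft, hn]; ext; simp⟩
  have h2 : (LinearMap.mulRight F (-x)) ^ n = 0 := by
    rw [LinearMap.pow_mulRight, neg_pow, hn]; ext; simp
  have h3 : adop F x = LinearMap.mulLeft F x + LinearMap.mulRight F (-x) := by
    ext z; simp [adop_apply, sub_eq_add_neg]
  rw [h3, nexp_add (commute_LR (F := F) x (-x)) h1 ⟨n, h2⟩, nexp_eq_sum h2,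
    nexp_eq_sum (a := LinearMap.mulLeft F x) (k := n) (by rw [LinearMap.pow_mulLeft, hn]; ext; simp),
    nexp_eq_sum hn, nexp_eq_sum (a := -x) (k := n) (by rw [neg_pow, hn, mul_zero])]
  simp only [LinearMap.pow_mulLeft, LinearMap.pow_mulRight, Module.End.mul_apply, LinearMap.sum_apply,
    LinearMap.smul_apply, LinearMap.mulLeft_apply, LinearMap.mulRight_apply, Finset.sum_mul,
    Finset.mul_sum, smul_mul_assoc, mul_smul_comm, mul_assoc]

theorem conj_expand {x : A} {N : ℕ} (hx : IsNilpotent x) (hN : (adop F x) ^ N = 0) (y : A) (t : F) :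
    nexp F (t • x) * y * nexp F (-(t • x)) =
      ∑ n ∈ Finset.range N, t ^ n • ((n.factorial : F)⁻¹ • ((adop F x) ^ n) y) := by
  rw [← nexp_adop (hx.smul t)]
  have : adop F (t • x) = t • adop F x := by
    ext z; simp [adop_apply, smul_sub]
  rw [this, nexp_smul_eq_sum hN]
  simp

/-- comparing Laurent polynomials -/
theorem laurent_compare {M : Type*} [AddCommGroup M] [Module F M] (N : ℕ) (hN : 3 ≤ N) (a b : ℕ → M)
    (ha : ∀ n, N ≤ n → a n = 0) (hb : ∀ n, N ≤ n → b n = 0)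
    (h : ∀ m : ℕ, 0 < m → ∑ n ∈ Finset.range N, (m : F) ^ n • a n =
      (m : F) ^ 2 • ∑ n ∈ Finset.range N, ((m : F)⁻¹) ^ n • b n) :
    (∀ n, 3 ≤ n → a n = 0) ∧ a 2 = b 0 ∧ a 1 = b 1 ∧ a 0 = b 2 := by
  have key := poly_zero (F := F) (N + N) (fun i => (if N ≤ i then a (i - N) else 0) -
      (if i < N + 3 then b (N + 2 - i) else 0)) (by
    intro m hm
    have hm0 : (m : F) ≠ 0 := by exact_mod_cast hm.ne'
    have h1 : ∑ i ∈ Finset.range (N + N), (m : F) ^ i • (if N ≤ i then a (i - N) else 0) =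
        (m : F) ^ N • ∑ n ∈ Finset.range N, (m : F) ^ n • a n := by
      rw [Finset.sum_range_add, Finset.sum_eq_zero, zero_add, Finset.smul_sum]
      · refine Finset.sum_congr rfl fun n _ => ?_
        simp [pow_add, smul_smul]
      · intro i hi
        rw [if_neg (by simpa using hi), smul_zero]
    have h2 : ∑ i ∈ Finset.range (N + N), (m : F) ^ i • (if i < N + 3 then b (N + 2 - i) else 0) =
        (m : F) ^ N • (m : F) ^ 2 • ∑ n ∈ Finset.range N, ((m : F)⁻¹) ^ n • b n := by
      have e1 : ∑ i ∈ Finset.range (N + N), (m : F) ^ i • (if i < N + 3 then b (N + 2 - i) else 0) =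
          ∑ i ∈ Finset.range (N + 3), (m : F) ^ i • b (N + 2 - i) := by
        symm
        apply Finset.sum_subset_zero_on_sdiff (Finset.range_subset_range.2 (by omega))
        · intro i hi
          rw [Finset.mem_sdiff, Finset.mem_range, Finset.mem_range] at hi
          rw [if_neg hi.2, smul_zero]
        · intro i hi
          rw [if_pos (Finset.mem_range.1 hi)]
      rw [e1, ← Finset.sum_range_reflect, smul_smul, Finset.smul_sum, Finset.sum_range_add,
        Finset.sum_eq_zero (s := Finset.range 3), add_zero]
      · refine Finset.sum_congr rfl fun n hn => ?_
        rw [Finset.mem_range] at hn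
        rw [show N + 2 - (N + 3 - 1 - n) = n by omega, smul_smul, ← pow_add]
        congr 1
        rw [inv_pow, ← div_eq_mul_inv, eq_div_iff (pow_ne_zero _ hm0), ← pow_add]
        congr 1; omega
      · intro i hi
        rw [Finset.mem_range] at hi
        rw [hb _ (by omega), smul_zero]
    simp only [smul_sub, Finset.sum_sub_distrib]
    rw [h1, h2, h m hm, sub_self])
  refine ⟨fun n hn => ?_, ?_, ?_, ?_⟩
  · by_cases hnN : N ≤ n
    · exact ha n hnN
    have := key (N + n) (by omega)
    simpa [show ¬ (n < 3) by omega] using this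
  · have := key (N + 2) (by omega)
    simpa [sub_eq_zero] using this
  · have := key (N + 1) (by omega)
    simpa [sub_eq_zero, show N + 2 - (N + 1) = 1 by omega] using this
  · have := key N (by omega)
    simpa [sub_eq_zero] using this

end adj


section bracket
variable {F A : Type*} [Field F] [Ring A] [Algebra F A]

/-- the commutator -/
def br {A : Type*} [Ring A] (a b : A) : A := a * b - b * a

theorem br_add (a b c : A) : br a (b + c) = br a b + br a c := by unfold br; noncomm_ring
theorem add_br (a b c : A) : br (a + b) c = br a c + br b c := by unfold br; noncomm_ring
theorem br_sub (a b c : A) : br a (b - c) = br a b - br a c := by unfold br; noncomm_ring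
theorem sub_br (a b c : A) : br (a - b) c = br a c - br b c := by unfold br; noncomm_ring
theorem br_neg (a b : A) : br a (-b) = -br a b := by unfold br; noncomm_ring
theorem neg_br (a b : A) : br (-a) b = -br a b := by unfold br; noncomm_ring
theorem br_zero (a : A) : br a 0 = 0 := by simp [br]
theorem zero_br (a : A) : br 0 a = 0 := by simp [br]
theorem br_smul (c : F) (a b : A) : br a (c • b) = c • br a b := by simp [br, smul_sub]
theorem smul_br (c : F) (a b : A) : br (c • a) b = c • br a b := by simp [br, smul_sub]
theorem br_skew (a b : A) : br a b = - br b a := by unfold br; noncomm_ring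
theorem br_self (a : A) : br a a = 0 := by simp [br]
theorem br_jacobi (a b c : A) : br a (br b c) = br (br a b) c + br b (br a c) := by
  unfold br; noncomm_ring
theorem br_eq_zero_iff {a b : A} : br a b = 0 ↔ Commute a b := sub_eq_zero
theorem br_conj (g g' a b : A) (h : g' * g = 1) :
    g * br a b * g' = br (g * a * g') (g * b * g') := by
  have h1 : ∀ a b : A, (g * a * g') * (g * b * g') = g * (a * b) * g' := by
    intro a b
    calc (g * a * g') * (g * b * g') = g * a * (g' * g) * b * g' := by noncomm_ring
      _ = _ := by rw [h]; noncomm_ring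
  unfold br
  rw [h1, h1]; noncomm_ring
end bracket

section adrel
variable {K F A : Type*} [Field K] [CharZero K] [Field F] [CharZero F] [Ring A] [Algebra F A]

omit [CharZero K] in
theorem addhom_natCast_mul (X : K →+ A) (m : ℕ) (x : K) : X ((m : K) * x) = (m : F) • X x := by
  rw [← nsmul_eq_mul, map_nsmul, Nat.cast_smul_eq_nsmul]

theorem addhom_inv_natCast_mul (X : K →+ A) (m : ℕ) (hm : 0 < m) (x : K) :
    X ((m : K)⁻¹ * x) = (m : F)⁻¹ • X x := by
  have h1 : (m : K) ≠ 0 := by exact_mod_cast hm.ne'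
  have h2 : (m : F) ≠ 0 := by exact_mod_cast hm.ne'
  rw [eq_inv_smul_iff₀ h2, ← addhom_natCast_mul, mul_inv_cancel_left₀ h1]

theorem ad_relations (X Y : K →+ A) (hX : ∀ x, IsNilpotent (X x)) (hY : ∀ x, IsNilpotent (Y x))
    (h : ∀ x : K, x ≠ 0 → ∀ y, nexp F (X x) * Y y * nexp F (-X x) =
      nexp F (Y x⁻¹) * X (-(x ^ 2 * y)) * nexp F (-Y x⁻¹)) (x y : K) :
    br (X x) (br (X x) (Y y)) = -((2 : F) • X (x ^ 2 * y)) ∧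
    nexp F (X x) * Y y * nexp F (-X x) = Y y + br (X x) (Y y) - X (x ^ 2 * y) := by
  by_cases hx : x = 0
  · subst hx
    simp [nexp_zero, br]
  obtain ⟨k, hk⟩ := adop_nilpotent (F := F) (hX x)
  obtain ⟨l, hl⟩ := adop_nilpotent (F := F) (hY x⁻¹)
  have hk' : adop F (X x) ^ (k + l + 3) = 0 := pow_eq_zero_of_le (by omega) hk
  have hl' : adop F (Y x⁻¹) ^ (k + l + 3) = 0 := pow_eq_zero_of_le (by omega) hl
  obtain ⟨h3, h2, h1, h0⟩ := laurent_compare (F := F) (k + l + 3) (by omega)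
    (fun n => (n.factorial : F)⁻¹ • ((adop F (X x)) ^ n) (Y y))
    (fun n => (n.factorial : F)⁻¹ • ((adop F (Y x⁻¹)) ^ n) (- X (x ^ 2 * y)))
    (fun n hn => by simp only [pow_eq_zero_of_le hn hk', LinearMap.zero_apply, smul_zero])
    (fun n hn => by simp only [pow_eq_zero_of_le hn hl', LinearMap.zero_apply, smul_zero])
    (by
      intro m hm
      have hm1 : (m : K) ≠ 0 := by exact_mod_cast hm.ne'
      rw [← conj_expand (hX x) hk', ← conj_expand (hY _) hl']
      have h5 := h (m * x) (mul_ne_zero hm1 hx) y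
      rw [mul_inv, addhom_inv_natCast_mul (F := F) Y m hm, addhom_natCast_mul (F := F),
        show -((m * x) ^ 2 * y) = (m : K) * ((m : K) * (- (x ^ 2 * y))) by ring,
        addhom_natCast_mul (F := F), addhom_natCast_mul (F := F)] at h5
      rw [h5, map_neg, smul_smul, ← pow_two, mul_smul_comm, smul_mul_assoc])
  simp only [Nat.factorial, Nat.cast_one, inv_one, one_smul, pow_zero, pow_one, Module.End.one_apply] at h0 h1 h2
  have e2 : br (X x) (br (X x) (Y y)) = -((2 : F) • X (x ^ 2 * y)) := by
    have : (adop F (X x) ^ 2) (Y y) = br (X x) (br (X x) (Y y)) := rfl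
    rw [this, inv_smul_eq_iff₀ (by norm_num)] at h2
    rw [h2]
    norm_num
  refine ⟨e2, ?_⟩
  have h6 := conj_expand (hX x) hk' (Y y) (1 : F)
  rw [one_smul] at h6
  rw [h6, ← Finset.sum_subset (s₁ := Finset.range 3)]
  · rw [Finset.sum_range_succ, Finset.sum_range_succ, Finset.sum_range_one]
    have : (adop F (X x) ^ 2) (Y y) = br (X x) (br (X x) (Y y)) := rfl
    rw [this, e2]
    have : (adop F (X x) ^ 1) (Y y) = br (X x) (Y y) := by rw [pow_one]; rfl
    rw [this]
    simp only [one_pow, one_smul, Nat.factorial, Nat.cast_one, inv_one, pow_zero, Module.End.one_apply,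
      smul_neg, smul_smul]
    norm_num
    abel
  · intro i hi
    simp at hi ⊢
    omega
  · intro i hi1 hi2
    simp at hi1 hi2
    rw [h3 i (by omega), smul_zero]

/-- polarization -/
theorem ad_polar (X Y : K →+ A) (hc : ∀ x y, Commute (X x) (X y))
    (h : ∀ x y, br (X x) (br (X x) (Y y)) = -((2 : F) • X (x ^ 2 * y))) (x x' y : K) :
    br (X x) (br (X x') (Y y)) = -((2 : F) • X (x * x' * y)) := by
  have hs : br (X x') (br (X x) (Y y)) = br (X x) (br (X x') (Y y)) := by
    have := (hc x x').eq
    simp only [br]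
    have e : (X x' * (X x * Y y - Y y * X x) - (X x * Y y - Y y * X x) * X x') -
      (X x * (X x' * Y y - Y y * X x') - (X x' * Y y - Y y * X x') * X x) =
      -((X x * X x' - X x' * X x) * Y y) + Y y * (X x * X x' - X x' * X x) := by noncomm_ring
    rw [this, sub_self] at e
    simpa [sub_eq_zero] using e
  have h1 := h (x + x') y
  rw [map_add, add_br, add_br, br_add, br_add, h, h, hs,
    show (x + x') ^ 2 * y = x ^ 2 * y + x * x' * y + x * x' * y + x' ^ 2 * y by ring, map_add, map_add, map_add] at h1
  have h2 : (2 : F) • br (X x) (br (X x') (Y y)) = (2 : F) • (-((2 : F) • X (x * x' * y))) := by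
    simp only [smul_add, two_smul] at h1 ⊢
    rw [← sub_eq_zero] at h1 ⊢
    rw [← h1]; abel
  exact smul_right_injective A (two_ne_zero' F) h2
end adrel

section logrep
variable {K F V G : Type*} [Field K] [CharZero K] [Field F] [CharZero F] [IsAlgClosed F] [AddCommGroup V]
  [Module F V] [FiniteDimensional F V] [Group G]

theorem rho_inv_mul (ρ : G →* Module.End F V) (g : G) : ρ g⁻¹ * ρ g = 1 := by
  rw [← map_mul, inv_mul_cancel, map_one]
theorem rho_mul_inv (ρ : G →* Module.End F V) (g : G) : ρ g * ρ g⁻¹ = 1 := by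
  rw [← map_mul, mul_inv_cancel, map_one]

theorem exists_log_rep (ρ : G →* Module.End F V) (u : K → G) (hu : ∀ x y, u (x + y) = u x * u y)
    (t : G) (ht : ∀ x, t * u x * t⁻¹ = u (2 * x)) :
    ∃ X : K →+ Module.End F V, (∀ x, IsNilpotent (X x)) ∧ (∀ x, ρ (u x) = nexp F (X x)) ∧
      ∀ x y, Commute (X x) (X y) := by
  have hu0 : u 0 = 1 := by have := hu 0 0; simpa using this
  have hupow : ∀ (n : ℕ) x, u ((n : K) * x) = u x ^ n := by
    intro n x
    induction n with
    | zero => simp [hu0]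
    | succ n ih => rw [Nat.cast_succ, add_mul, one_mul, hu, ih, pow_succ]
  have hunip : ∀ x, IsNilpotent (ρ (u x) - 1) := by
    intro x
    set N := (2 ^ Module.finrank F V).factorial with hN
    have hN0 : (N : K) ≠ 0 := by exact_mod_cast Nat.factorial_ne_zero _
    refine unipotent_of_conj (ρ (u ((N : K)⁻¹ * x))) (ρ t) (ρ t⁻¹) _ (rho_inv_mul ρ t) (rho_mul_inv ρ t) ?_ ?_ ?_
    · exact (Group.isUnit _).map ρ
    · rw [← map_mul, ← map_mul, ht, two_mul, hu, map_mul, pow_two]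
    · rw [← hN, ← map_pow, ← hupow, mul_inv_cancel_left₀ hN0]
  choose X hXn hX using fun x => exists_log (F := F) (ρ (u x)) (hunip x)
  have hnat : ∀ (n : ℕ) x, X ((n : K) * x) = (n : F) • X x := by
    intro n x
    apply nexp_inj (F := F) (hXn _) ((hXn _).smul _)
    rw [hX, hupow, map_pow, isNilpotent_nexp_nsmul (hXn _), hX]
  have hcomm : ∀ x y, Commute (X x) (X y) := by
    intro x y
    apply commute_of_commute_nexp (F := F) (hXn x)
    intro m
    rw [← hnat, hX]
    have h1 : ρ (u (m * x)) * X y * ρ (u (m * x))⁻¹ = X y := by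
      apply nexp_inj (F := F) (isNilpotent_conj (rho_inv_mul ρ _) (rho_mul_inv ρ _) (hXn y)) (hXn y)
      rw [nexp_conj (rho_inv_mul ρ _) (rho_mul_inv ρ _) (hXn y), hX, ← map_mul, ← map_mul, ← hu,
        add_comm, hu, mul_inv_cancel_right]
    have h2 := congrArg (· * ρ (u (m * x))) h1
    simp only [mul_assoc, rho_inv_mul, mul_one] at h2
    exact h2
  refine ⟨AddMonoidHom.mk' X ?_, hXn, fun x => (hX x).symm, hcomm⟩
  intro x y
  apply nexp_inj (F := F) (hXn _) ((hcomm x y).isNilpotent_add (hXn x) (hXn y))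
  rw [nexp_add (hcomm x y) (hXn x) (hXn y), hX, hX, hX, hu, map_mul]

theorem conj_log (ρ : G →* Module.End F V) {g a b : G} {X Y : Module.End F V} (hX : IsNilpotent X)
    (hY : IsNilpotent Y) (ha : ρ a = nexp F X) (hb : ρ b = nexp F Y) (h : g * a = b * g) :
    ρ g * X * ρ g⁻¹ = Y := by
  apply nexp_inj (F := F) (isNilpotent_conj (rho_inv_mul ρ _) (rho_mul_inv ρ _) hX) hY
  rw [nexp_conj (rho_inv_mul ρ _) (rho_mul_inv ρ _) hX, ← ha, ← hb, ← map_mul, ← map_mul, h,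
    mul_inv_cancel_right]
end logrep

section GL2
open Matrix
variable {K : Type*} [Field K]

/-- upper unipotent -/
def uu (x : K) : GL (Fin 2) K := GeneralLinearGroup.mkOfDetNeZero !![1, x; 0, 1] (by simp)
/-- lower unipotent -/
def vv (x : K) : GL (Fin 2) K := GeneralLinearGroup.mkOfDetNeZero !![1, 0; x, 1] (by simp)
/-- diagonal element -/
def dd (b : Kˣ) : GL (Fin 2) K := GeneralLinearGroup.mkOfDetNeZero !![1, 0; 0, (b : K)] (by simp)

@[simp] theorem uu_coe (x : K) : (uu x : Matrix (Fin 2) (Fin 2) K) = !![1, x; 0, 1] := rfl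
@[simp] theorem vv_coe (x : K) : (vv x : Matrix (Fin 2) (Fin 2) K) = !![1, 0; x, 1] := rfl
@[simp] theorem dd_coe (b : Kˣ) : (dd b : Matrix (Fin 2) (Fin 2) K) = !![1, 0; 0, (b : K)] := rfl

theorem uu_add (x y : K) : uu (x + y) = uu x * uu y := by
  apply Units.ext; simp [add_comm]
theorem vv_add (x y : K) : vv (x + y) = vv x * vv y := by
  apply Units.ext; simp
theorem uu_zero : uu (0 : K) = 1 := by apply Units.ext; simp [Matrix.one_fin_two]
theorem vv_zero : vv (0 : K) = 1 := by apply Units.ext; simp [Matrix.one_fin_two]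
theorem uu_inv (x : K) : (uu x)⁻¹ = uu (-x) := by
  rw [inv_eq_iff_mul_eq_one, ← uu_add, add_neg_cancel, uu_zero]
theorem vv_inv (x : K) : (vv x)⁻¹ = vv (-x) := by
  rw [inv_eq_iff_mul_eq_one, ← vv_add, add_neg_cancel, vv_zero]
theorem dd_mul (a b : Kˣ) : dd (a * b) = dd a * dd b := by
  apply Units.ext; simp
theorem dd_uu (b : Kˣ) (x : K) : dd b * uu x = uu ((b : K)⁻¹ * x) * dd b := by
  apply Units.ext; simp [mul_comm]
theorem dd_vv (b : Kˣ) (x : K) : dd b * vv x = vv (b * x) * dd b := by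
  apply Units.ext; simp
theorem uvu (x y : K) (hx : x ≠ 0) : (vv (-x⁻¹) * uu x) * vv y = uu (-(x ^ 2 * y)) * (vv (-x⁻¹) * uu x) := by
  apply Units.ext; simp; field_simp; simp
theorem vuv (x y : K) (hx : x ≠ 0) : (uu (-x⁻¹) * vv x) * uu y = vv (-(x ^ 2 * y)) * (uu (-x⁻¹) * vv x) := by
  apply Units.ext; simp; field_simp; simp

theorem GL2_gen (P : GL (Fin 2) K → Prop) (hmul : ∀ g h, P g → P h → P (g * h))
    (hu : ∀ x, P (uu x)) (hv : ∀ x, P (vv x)) (hd : ∀ b, P (dd b)) (g : GL (Fin 2) K) : P g := by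
  have hh : ∀ a : Kˣ, ∃ h : GL (Fin 2) K, P h ∧ (h : Matrix (Fin 2) (Fin 2) K) = !![(a : K), 0; 0, (a : K)⁻¹] := by
    intro a
    refine ⟨(uu (a : K) * vv (-(a : K)⁻¹) * uu (a : K)) * (uu (-1) * vv 1 * uu (-1)), ?_, ?_⟩
    · exact hmul _ _ (hmul _ _ (hmul _ _ (hu _) (hv _)) (hu _)) (hmul _ _ (hmul _ _ (hu _) (hv _)) (hu _))
    · simp
  have key : ∀ g : GL (Fin 2) K, (g : Matrix (Fin 2) (Fin 2) K) 0 0 ≠ 0 → P g := by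
    intro g hg
    set a := (g : Matrix (Fin 2) (Fin 2) K) 0 0 with ha
    obtain ⟨h, hP, hm⟩ := hh (Units.mk0 a hg)
    have hdet : (g : Matrix (Fin 2) (Fin 2) K).det ≠ 0 := g.det.ne_zero
    have : g = vv ((g : Matrix (Fin 2) (Fin 2) K) 1 0 / a) * (h * dd (Units.mk0 _ hdet)) *
        uu ((g : Matrix (Fin 2) (Fin 2) K) 0 1 / a) := by
      apply Units.ext
      simp only [Units.val_mul, hm]
      ext i j
      fin_cases i <;> fin_cases j <;> simp [← ha, Matrix.det_fin_two, Matrix.mul_apply, Fin.sum_univ_two] <;> field_simp <;> ring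
    rw [this]
    exact hmul _ _ (hmul _ _ (hv _) (hmul _ _ hP (hd _))) (hu _)
  by_cases hg : (g : Matrix (Fin 2) (Fin 2) K) 0 0 = 0
  · have hdet : (g : Matrix (Fin 2) (Fin 2) K).det ≠ 0 := g.det.ne_zero
    have h1 : P (uu 1 * g) := by
      apply key
      rw [Matrix.det_fin_two, hg] at hdet
      simp [Matrix.mul_apply, Fin.sum_univ_two, hg]
      intro h
      simp [h] at hdet
    have : g = uu (-1) * (uu 1 * g) := by
      rw [← mul_assoc, ← uu_add, neg_add_cancel, uu_zero, one_mul]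
    rw [this]
    exact hmul _ _ (hu _) h1
  · exact key g hg
end GL2


section P4
open Matrix
variable {K F V : Type*} [Field K] [CharZero K] [Field F] [CharZero F] [IsAlgClosed F] [AddCommGroup V]
  [Module F V] [FiniteDimensional F V]

/-- infinitesimal data attached to a representation of `GL_2(K)` -/
structure LogData (ρ : GL (Fin 2) K →* Module.End F V) (X Y : K →+ Module.End F V) : Prop where
  nX : ∀ x, IsNilpotent (X x)
  nY : ∀ x, IsNilpotent (Y x)
  eX : ∀ x, ρ (uu x) = nexp F (X x)
  eY : ∀ x, ρ (vv x) = nexp F (Y x)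
  cX : ∀ x y, Commute (X x) (X y)
  cY : ∀ x y, Commute (Y x) (Y y)
  adX : ∀ x y, ρ (uu x) * Y y * ρ (uu x)⁻¹ = Y y + br (X x) (Y y) - X (x ^ 2 * y)
  adY : ∀ x y, ρ (vv x) * X y * ρ (vv x)⁻¹ = X y + br (Y x) (X y) - Y (x ^ 2 * y)
  ddX : ∀ b x, ρ (dd b) * X x * ρ (dd b)⁻¹ = X ((b : K)⁻¹ * x)
  ddY : ∀ b x, ρ (dd b) * Y x * ρ (dd b)⁻¹ = Y ((b : K) * x)
  polX : ∀ x x' y, br (X x) (br (X x') (Y y)) = -((2 : F) • X (x * x' * y))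
  polY : ∀ x x' y, br (Y x) (br (Y x') (X y)) = -((2 : F) • Y (x * x' * y))

theorem conj_eq_of {A : Type*} [Ring A] {a a' b b' y z : A} (hb2 : b * b' = 1)
    (h : (b' * a) * y * (a' * b) = z) : a * y * a' = b * z * b' := by
  rw [← h]
  calc a * y * a' = (b * b') * a * y * a' * (b * b') := by rw [hb2]; simp
    _ = _ := by noncomm_ring

theorem exists_logData (ρ : GL (Fin 2) K →* Module.End F V) : ∃ X Y, LogData ρ X Y := by
  have h2 : (2 : K) ≠ 0 := two_ne_zero
  obtain ⟨X, nX, eX, cX⟩ := exists_log_rep ρ uu uu_add (dd (Units.mk0 2 h2)⁻¹) (by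
    intro x; rw [dd_uu, mul_inv_cancel_right]; simp)
  obtain ⟨Y, nY, eY, cY⟩ := exists_log_rep ρ vv vv_add (dd (Units.mk0 2 h2)) (by
    intro x; rw [dd_vv, mul_inv_cancel_right]; simp)
  have eX' : ∀ x, ρ (uu x)⁻¹ = nexp F (-X x) := by intro x; rw [uu_inv, eX, map_neg]
  have eY' : ∀ x, ρ (vv x)⁻¹ = nexp F (-Y x) := by intro x; rw [vv_inv, eY, map_neg]
  have hXY : ∀ x : K, x ≠ 0 → ∀ y, nexp F (X x) * Y y * nexp F (-X x) =
      nexp F (Y x⁻¹) * X (-(x ^ 2 * y)) * nexp F (-Y x⁻¹) := by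
    intro x hx y
    apply conj_eq_of (nexp_mul_neg (nY _))
    have := conj_log ρ (nY y) (nX _) (eY y) (eX _) (uvu x y hx)
    rw [_root_.mul_inv_rev, map_mul, map_mul, eX', vv_inv, neg_neg, eY, eY, eX, map_neg] at this
    exact this
  have hYX : ∀ x : K, x ≠ 0 → ∀ y, nexp F (Y x) * X y * nexp F (-Y x) =
      nexp F (X x⁻¹) * Y (-(x ^ 2 * y)) * nexp F (-X x⁻¹) := by
    intro x hx y
    apply conj_eq_of (nexp_mul_neg (nX _))
    have := conj_log ρ (nX y) (nY _) (eX y) (eY _) (vuv x y hx)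
    rw [_root_.mul_inv_rev, map_mul, map_mul, eY', uu_inv, neg_neg, eX, eX, eY, map_neg] at this
    exact this
  have r1 := ad_relations X Y nX nY hXY
  have r2 := ad_relations Y X nY nX hYX
  refine ⟨X, Y, nX, nY, eX, eY, cX, cY, ?_, ?_, ?_, ?_, ?_, ?_⟩
  · intro x y; rw [eX', eX]; exact (r1 x y).2
  · intro x y; rw [eY', eY]; exact (r2 x y).2
  · intro b x; exact conj_log ρ (nX _) (nX _) (eX _) (eX _) (dd_uu b x)
  · intro b x; exact conj_log ρ (nY _) (nY _) (eY _) (eY _) (dd_vv b x)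
  · exact ad_polar X Y cX (fun x y => (r1 x y).1)
  · exact ad_polar Y X cY (fun x y => (r2 x y).1)

/-- irreducibility -/
def Irr {G : Type*} [Group G] (ρ : G →* Module.End F V) : Prop :=
  ∀ W : Submodule F V, (∀ g, ∀ w ∈ W, ρ g w ∈ W) → W = ⊥ ∨ W = ⊤

theorem ker_stable_zero (ρ : GL (Fin 2) K →* Module.End F V) (hirr : Irr ρ) (S : Submodule F (Module.End F V))
    (hu : ∀ x, ∀ f ∈ S, ρ (uu x) * f * ρ (uu x)⁻¹ ∈ S)
    (hv : ∀ x, ∀ f ∈ S, ρ (vv x) * f * ρ (vv x)⁻¹ ∈ S)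
    (hd : ∀ x, ∀ f ∈ S, ρ (dd x) * f * ρ (dd x)⁻¹ ∈ S)
    (hv0 : ∃ v ≠ 0, ∀ f ∈ S, f v = 0) : ∀ f ∈ S, f = 0 := by
  have hall : ∀ g, ∀ f ∈ S, ρ g * f * ρ g⁻¹ ∈ S := by
    intro g
    refine GL2_gen (fun g => ∀ f ∈ S, ρ g * f * ρ g⁻¹ ∈ S) ?_ hu hv hd g
    intro g h hg hh f hf
    have := hg _ (hh f hf)
    rw [_root_.mul_inv_rev, map_mul, map_mul]
    simpa only [mul_assoc] using this
  let W : Submodule F V :=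
    { carrier := {v | ∀ f ∈ S, f v = 0}
      add_mem' := by
        intro a b ha hb f hf
        rw [map_add, ha f hf, hb f hf, add_zero]
      zero_mem' := by intro f hf; simp
      smul_mem' := by
        intro c a ha f hf
        rw [map_smul, ha f hf, smul_zero] }
  rcases hirr W (by
    intro g w hw f hf
    have h1 := hw _ (hall g⁻¹ f hf)
    rw [inv_inv] at h1
    have h2 := congrArg (ρ g) h1
    rw [map_zero, ← Module.End.mul_apply, ← mul_assoc, ← mul_assoc, rho_mul_inv, one_mul] at h2
    exact h2) with h | h
  · obtain ⟨v, hv, hv'⟩ := hv0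
    have : v ∈ W := hv'
    rw [h] at this
    exact (hv this).elim
  · intro f hf
    ext v
    have : v ∈ W := by rw [h]; trivial
    exact this f hf

theorem comm_nil_stable_zero [Nontrivial V] (ρ : GL (Fin 2) K →* Module.End F V) (hirr : Irr ρ)
    (T : Set (Module.End F V))
    (hc : ∀ f ∈ T, ∀ g ∈ T, Commute f g) (hn : ∀ f ∈ T, IsNilpotent f)
    (hu : ∀ x, ∀ f ∈ T, ρ (uu x) * f * ρ (uu x)⁻¹ ∈ Submodule.span F T)
    (hv : ∀ x, ∀ f ∈ T, ρ (vv x) * f * ρ (vv x)⁻¹ ∈ Submodule.span F T)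
    (hd : ∀ x, ∀ f ∈ T, ρ (dd x) * f * ρ (dd x)⁻¹ ∈ Submodule.span F T) : ∀ f ∈ T, f = 0 := by
  have ext : ∀ a b : Module.End F V, (∀ f ∈ T, a * f * b ∈ Submodule.span F T) →
      ∀ f ∈ Submodule.span F T, a * f * b ∈ Submodule.span F T := by
    intro a b h f hf
    induction hf using Submodule.span_induction with
    | mem x hx => exact h x hx
    | zero => simp
    | add x y _ _ hx hy => rw [mul_add, add_mul]; exact add_mem hx hy
    | smul c x _ hx => rw [mul_smul_comm, smul_mul_assoc]; exact Submodule.smul_mem _ _ hx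
  intro f hf
  refine ker_stable_zero ρ hirr (Submodule.span F T) (fun x => ext _ _ (hu x)) (fun x => ext _ _ (hv x))
    (fun x => ext _ _ (hd x)) ?_ f (Submodule.subset_span hf)
  obtain ⟨v, -, hv0, hv⟩ := exists_common_eigenvector T hc ⊤ top_ne_bot (by simp)
  refine ⟨v, hv0, ?_⟩
  intro f hf
  induction hf using Submodule.span_induction with
  | mem x hx =>
    obtain ⟨μ, hμ⟩ := hv x hx
    rw [hμ, eigenvalue_zero_of_nilpotent x (hn x hx) v hv0 μ hμ, zero_smul]
  | zero => simp
  | add x y _ _ hx hy => simp [hx, hy]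
  | smul c x _ hx => simp [hx]

theorem nilp_of_comm_br (a b c d : Module.End F V) (ha : Commute a (br a b - br c d))
    (hb : Commute b (br a b - br c d)) (hc : Commute c (br a b - br c d)) (hd : Commute d (br a b - br c d)) :
    IsNilpotent (br a b - br c d) := by
  apply isNilpotent_of_spectrum
  intro μ hμ
  set D := br a b - br c d with hD
  rw [← Module.End.hasEigenvalue_iff_mem_spectrum] at hμ
  have hst : ∀ f : Module.End F V, Commute f D → ∀ x ∈ Module.End.eigenspace D μ, f x ∈ Module.End.eigenspace D μ := by
    intro f hf x hx
    rw [Module.End.mem_eigenspace_iff] at hx ⊢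
    rw [← Module.End.mul_apply, ← hf.eq, Module.End.mul_apply, hx, map_smul]
  set W := Module.End.eigenspace D μ
  have hDW : ∀ x ∈ W, D x ∈ W := hst D (Commute.refl _)
  have e : D.restrict hDW = br (a.restrict (hst a ha)) (b.restrict (hst b hb)) -
      br (c.restrict (hst c hc)) (d.restrict (hst d hd)) := by
    ext x; rfl
  have e2 : D.restrict hDW = μ • (1 : Module.End F W) := by
    ext x
    exact Module.End.mem_eigenspace_iff.1 x.2
  have ht := congrArg (LinearMap.trace F W) (e.symm.trans e2)
  simp only [br, map_sub, LinearMap.trace_mul_comm F (a.restrict _), LinearMap.trace_mul_comm F (c.restrict _), sub_self, map_smul,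
    LinearMap.trace_one] at ht
  have hW : W ≠ ⊥ := hμ
  have : Module.finrank F W ≠ 0 := by
    rw [Ne, Submodule.finrank_eq_zero]; exact hW
  have h3 : (Module.finrank F W : F) ≠ 0 := by exact_mod_cast this
  rw [smul_eq_mul] at ht
  exact (mul_eq_zero.1 ht.symm).resolve_right h3

theorem LogData.br_eq [Nontrivial V] {ρ : GL (Fin 2) K →* Module.End F V} (hirr : Irr ρ)
    {X Y : K →+ Module.End F V} (L : LogData ρ X Y) (x y : K) : br (X x) (Y y) = br (X (x * y)) (Y 1) := by
  set D : K → K → Module.End F V := fun x y => br (X x) (Y y) - br (X (x * y)) (Y 1) with hD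
  have hXD : ∀ s x y, Commute (X s) (D x y) := by
    intro s x y
    rw [← br_eq_zero_iff, hD]
    simp only
    rw [br_sub, L.polX, L.polX]
    ring_nf; simp
  have hYD : ∀ s x y, Commute (Y s) (D x y) := by
    intro s x y
    rw [← br_eq_zero_iff, hD]
    simp only
    rw [br_skew (X x), br_skew (X (x * y)), br_sub, br_neg, br_neg, L.polY, L.polY]
    ring_nf; simp
  have hBD : ∀ s t x y, Commute (br (X s) (Y t)) (D x y) := by
    intro s t x y
    exact ((hXD s x y).mul_left (hYD t x y)).sub_left ((hYD t x y).mul_left (hXD s x y))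
  have key := comm_nil_stable_zero ρ hirr {f | ∃ x y, f = D x y} ?_ ?_ ?_ ?_ ?_
  · have := key (D x y) ⟨x, y, rfl⟩
    exact sub_eq_zero.1 this
  · rintro _ ⟨x, y, rfl⟩ _ ⟨x', y', rfl⟩
    exact (hBD _ _ _ _).sub_left (hBD _ _ _ _)
  · rintro _ ⟨x, y, rfl⟩
    exact nilp_of_comm_br _ _ _ _ (hXD _ _ _) (hYD _ _ _) (hXD _ _ _) (hYD _ _ _)
  · rintro z _ ⟨x, y, rfl⟩
    rw [L.eX, (commute_nexp (L.nX z) (hXD z x y)).eq, ← L.eX, mul_assoc, rho_mul_inv, mul_one]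
    exact Submodule.subset_span ⟨x, y, rfl⟩
  · rintro z _ ⟨x, y, rfl⟩
    rw [L.eY, (commute_nexp (L.nY z) (hYD z x y)).eq, ← L.eY, mul_assoc, rho_mul_inv, mul_one]
    exact Submodule.subset_span ⟨x, y, rfl⟩
  · rintro b _ ⟨x, y, rfl⟩
    have : ρ (dd b) * D x y * ρ (dd b)⁻¹ = D ((b : K)⁻¹ * x) (b * y) - D ((b : K)⁻¹ * (x * y)) b := by
      simp only [hD]
      rw [mul_sub, sub_mul, br_conj _ _ _ _ (rho_inv_mul ρ _), br_conj _ _ _ _ (rho_inv_mul ρ _),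
        L.ddX, L.ddX, L.ddY, L.ddY, mul_one]
      have hb := b.ne_zero
      rw [show (b : K)⁻¹ * x * (b * y) = x * y by field_simp, show (b : K)⁻¹ * (x * y) * b = x * y by field_simp]
      abel
    rw [this]
    exact sub_mem (Submodule.subset_span ⟨_, _, rfl⟩) (Submodule.subset_span ⟨_, _, rfl⟩)
end P4


set_option linter.unusedSectionVars false
section P5
open Matrix
variable {K F V : Type*} [Field K] [CharZero K] [Field F] [CharZero F] [IsAlgClosed F] [AddCommGroup V]
  [Module F V] [FiniteDimensional F V]

/-- extended data over a commutative algebra `R` -/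
structure SL2Data {R : Type*} [CommRing R] [Algebra F R] (ρ : GL (Fin 2) K →* Module.End F V) (ι : K →* R)
    (X Y H : R →ₗ[F] Module.End F V) : Prop where
  XY : ∀ μ ν, br (X μ) (Y ν) = H (μ * ν)
  HX : ∀ μ ν, br (H μ) (X ν) = (2 : F) • X (μ * ν)
  HY : ∀ μ ν, br (H μ) (Y ν) = -((2 : F) • Y (μ * ν))
  cX : ∀ μ ν, Commute (X μ) (X ν)
  cY : ∀ μ ν, Commute (Y μ) (Y ν)
  nX : ∀ μ, IsNilpotent (X μ)
  nY : ∀ μ, IsNilpotent (Y μ)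
  eX : ∀ x, ρ (uu x) = nexp F (X (ι x))
  eY : ∀ x, ρ (vv x) = nexp F (Y (ι x))
  dX : ∀ b μ, ρ (dd b) * X μ * ρ (dd b)⁻¹ = X (ι (b : K)⁻¹ * μ)
  dY : ∀ b μ, ρ (dd b) * Y μ * ρ (dd b)⁻¹ = Y (ι (b : K) * μ)
  uY : ∀ x μ, ρ (uu x) * Y μ * ρ (uu x)⁻¹ = Y μ + H (ι x * μ) - X (ι x ^ 2 * μ)
  vX : ∀ x μ, ρ (vv x) * X μ * ρ (vv x)⁻¹ = X μ - H (ι x * μ) - Y (ι x ^ 2 * μ)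
  addX : ∀ x y, X (ι (x + y)) = X (ι x) + X (ι y)

section ma
variable {A : Type*} [AddCommGroup A] [Module F A]

theorem ma_induction {P : MonoidAlgebra F K → Prop} (μ : MonoidAlgebra F K)
    (hadd : ∀ x y, P x → P y → P (x + y)) (hsmul : ∀ (c : F) x, P x → P (c • x))
    (hof : ∀ x, P (MonoidAlgebra.of F K x)) : P μ := by
  induction μ using MonoidAlgebra.induction_linear with
  | zero => simpa using hsmul 0 _ (hof 1)
  | add x y hx hy => exact hadd _ _ hx hy
  | single m r => simpa using hsmul r _ (hof m)

/-- linear extension -/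
noncomputable def maext (f : K → A) : MonoidAlgebra F K →ₗ[F] A :=
  (Finsupp.linearCombination F f).comp (MonoidAlgebra.coeffLinearEquiv F).toLinearMap

theorem maext_of (f : K → A) (x : K) : maext f (MonoidAlgebra.of F K x) = f x := by
  simp [maext, MonoidAlgebra.of]

theorem ma_hom_ext {f g : MonoidAlgebra F K →ₗ[F] A}
    (h : ∀ x, f (MonoidAlgebra.of F K x) = g (MonoidAlgebra.of F K x)) (μ) : f μ = g μ := by
  induction μ using ma_induction with
  | hadd x y hx hy => rw [map_add, map_add, hx, hy]
  | hsmul c x hx => rw [map_smul, map_smul, hx]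
  | hof x => exact h x
end ma

theorem ma_bilin {A : Type*} [Ring A] [Algebra F A] {P Q T : MonoidAlgebra F K →ₗ[F] A} 
    (h : ∀ x y, br (P (MonoidAlgebra.of F K x)) (Q (MonoidAlgebra.of F K y)) = T (MonoidAlgebra.of F K (x * y)))
    (μ ν) : br (P μ) (Q ν) = T (μ * ν) := by
  induction μ using ma_induction with
  | hadd x y hx hy => rw [map_add, add_br, hx, hy, add_mul, map_add]
  | hsmul c x hx => rw [map_smul, smul_br, hx, smul_mul_assoc, map_smul]
  | hof x =>
    induction ν using ma_induction with
    | hadd x y hx hy => rw [map_add, br_add, hx, hy, mul_add, map_add]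
    | hsmul c x hx => rw [map_smul, br_smul, hx, mul_smul_comm, map_smul]
    | hof y => rw [h, map_mul]

theorem ma_nil {A : Type*} [Ring A] [Algebra F A] {P : MonoidAlgebra F K →ₗ[F] A} (hc : ∀ μ ν, Commute (P μ) (P ν))
    (h : ∀ x, IsNilpotent (P (MonoidAlgebra.of F K x))) (μ) : IsNilpotent (P μ) := by
  induction μ using ma_induction with
  | hadd x y hx hy => rw [map_add]; exact (hc _ _).isNilpotent_add hx hy
  | hsmul c x hx => rw [map_smul]; exact hx.smul c
  | hof x => exact h x

/-- conjugation as a linear map -/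
def conjL (F : Type*) {A : Type*} [Field F] [Ring A] [Algebra F A] (a b : A) : A →ₗ[F] A where
  toFun x := a * x * b
  map_add' x y := by rw [mul_add, add_mul]
  map_smul' c x := by simp
/-- multiplication -/
def mulL (F : Type*) {A : Type*} [Field F] [Ring A] [Algebra F A] (a : A) : A →ₗ[F] A where
  toFun x := a * x
  map_add' x y := by rw [mul_add]
  map_smul' c x := by simp

theorem LogData.toSL2 [Nontrivial V] {ρ : GL (Fin 2) K →* Module.End F V} (hirr : Irr ρ)
    {X Y : K →+ Module.End F V} (L : LogData ρ X Y) :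
    SL2Data ρ (MonoidAlgebra.of F K) (maext X) (maext Y) (maext (fun x => br (X x) (Y 1))) := by
  have hB := L.br_eq hirr
  have cX : ∀ μ ν : MonoidAlgebra F K, Commute (maext (F := F) X μ) (maext X ν) := by
    intro μ ν
    rw [← br_eq_zero_iff]
    have := ma_bilin (F := F) (P := maext X) (Q := maext X) (T := 0) (fun x y => by
      rw [maext_of, maext_of, br_eq_zero_iff.2 (L.cX _ _)]; rfl) μ ν
    exact this
  have cY : ∀ μ ν : MonoidAlgebra F K, Commute (maext (F := F) Y μ) (maext Y ν) := by
    intro μ ν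
    rw [← br_eq_zero_iff]
    have := ma_bilin (F := F) (P := maext Y) (Q := maext Y) (T := 0) (fun x y => by
      rw [maext_of, maext_of, br_eq_zero_iff.2 (L.cY _ _)]; rfl) μ ν
    exact this
  refine ⟨?_, ?_, ?_, cX, cY, ?_, ?_, ?_, ?_, ?_, ?_, ?_, ?_, ?_⟩
  · apply ma_bilin
    intro x y
    rw [maext_of, maext_of, maext_of, hB]
  · have := ma_bilin (F := F) (P := maext (fun x => br (X x) (Y 1))) (Q := maext X) (T := (2 : F) • maext X) (by
      intro x y
      rw [maext_of, maext_of, LinearMap.smul_apply, maext_of, br_skew, L.polX, neg_neg]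
      ring_nf)
    exact this
  · have := ma_bilin (F := F) (P := maext (fun x => br (X x) (Y 1))) (Q := maext Y) (T := -((2 : F) • maext Y)) (by
      intro x y
      rw [maext_of, maext_of, LinearMap.neg_apply, LinearMap.smul_apply, maext_of, br_skew, br_skew (X x), br_neg, L.polY, neg_neg]
      ring_nf)
    exact this
  · exact ma_nil cX (fun x => by rw [maext_of]; exact L.nX x)
  · exact ma_nil cY (fun x => by rw [maext_of]; exact L.nY x)
  · intro x; rw [maext_of, L.eX]
  · intro x; rw [maext_of, L.eY]
  · intro b
    refine ma_hom_ext (f := (conjL F (ρ (dd b)) (ρ (dd b)⁻¹)).comp (maext X))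
      (g := (maext X).comp (mulL F (MonoidAlgebra.of F K (b : K)⁻¹))) ?_
    intro x
    change ρ (dd b) * maext X _ * ρ (dd b)⁻¹ = maext X (_ * _)
    rw [← map_mul, maext_of, maext_of, L.ddX]
  · intro b
    refine ma_hom_ext (f := (conjL F (ρ (dd b)) (ρ (dd b)⁻¹)).comp (maext Y))
      (g := (maext Y).comp (mulL F (MonoidAlgebra.of F K (b : K)))) ?_
    intro x
    change ρ (dd b) * maext Y _ * ρ (dd b)⁻¹ = maext Y (_ * _)
    rw [← map_mul, maext_of, maext_of, L.ddY]
  · intro z μ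
    induction μ using ma_induction with
    | hadd x y hx hy =>
      rw [map_add, mul_add, add_mul, hx, hy, mul_add, mul_add, map_add, map_add]; abel
    | hsmul c x hx =>
      rw [map_smul, mul_smul_comm, smul_mul_assoc, hx]
      simp only [mul_smul_comm, map_smul, smul_sub, smul_add]
    | hof x => rw [← map_pow, ← map_mul, ← map_mul, maext_of, maext_of, maext_of, L.adX, hB]
  · intro z μ
    induction μ using ma_induction with
    | hadd x y hx hy =>
      rw [map_add, mul_add, add_mul, hx, hy, mul_add, mul_add, map_add, map_add]; abel
    | hsmul c x hx =>
      rw [map_smul, mul_smul_comm, smul_mul_assoc, hx]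
      simp only [mul_smul_comm, map_smul, smul_sub]
    | hof x =>
      rw [← map_pow, ← map_mul, ← map_mul, maext_of, maext_of, maext_of, L.adY, br_skew, hB, mul_comm z x]
      abel
  · intro x y; simp only [maext_of, map_add]

namespace SL2Data
variable {R : Type*} [CommRing R] [Algebra F R] {ρ : GL (Fin 2) K →* Module.End F V} {ι : K →* R}
    {X Y H : R →ₗ[F] Module.End F V} (S : SL2Data ρ ι X Y H)
include S

theorem HH (μ ν) : Commute (H μ) (H ν) := by
  rw [← br_eq_zero_iff]
  have : H ν = br (X ν) (Y 1) := by rw [S.XY, mul_one]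
  rw [this, br_jacobi, S.HX, S.HY, smul_br, br_neg, br_smul, S.XY, S.XY]
  ring_nf; simp

theorem uX (x μ) : ρ (uu x) * X μ * ρ (uu x)⁻¹ = X μ := by
  rw [S.eX, (commute_nexp (S.nX _) (S.cX _ _)).eq, ← S.eX, mul_assoc, rho_mul_inv, mul_one]
theorem vY (x μ) : ρ (vv x) * Y μ * ρ (vv x)⁻¹ = Y μ := by
  rw [S.eY, (commute_nexp (S.nY _) (S.cY _ _)).eq, ← S.eY, mul_assoc, rho_mul_inv, mul_one]
theorem uH (x μ) : ρ (uu x) * H μ * ρ (uu x)⁻¹ = H μ - (2 : F) • X (ι x * μ) := by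
  have : H μ = br (X μ) (Y 1) := by rw [S.XY, mul_one]
  rw [this, br_conj _ _ _ _ (rho_inv_mul ρ _), S.uX, S.uY, br_sub, br_add, br_skew (X μ) (H _), S.HX,
    br_eq_zero_iff.2 (S.cX _ _)]
  ring_nf; abel
theorem vH (x μ) : ρ (vv x) * H μ * ρ (vv x)⁻¹ = H μ + (2 : F) • Y (ι x * μ) := by
  have : H μ = br (X μ) (Y 1) := by rw [S.XY, mul_one]
  rw [this, br_conj _ _ _ _ (rho_inv_mul ρ _), S.vY, S.vX, sub_br, sub_br, S.HY,
    br_eq_zero_iff.2 (S.cY _ _)]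
  ring_nf; abel
theorem dH (b μ) : ρ (dd b) * H μ * ρ (dd b)⁻¹ = H μ := by
  have : H μ = br (X μ) (Y 1) := by rw [S.XY, mul_one]
  rw [this, br_conj _ _ _ _ (rho_inv_mul ρ _), S.dX, S.dY, S.XY, S.XY, mul_one, mul_one,
    mul_right_comm, ← map_mul, inv_mul_cancel₀ b.ne_zero, map_one, one_mul]

theorem H_zero {μ} (h : X μ = 0) : H μ = 0 := by
  rw [← mul_one μ, ← S.XY, h, zero_br]
theorem X_mul {μ} (h : X μ = 0) (ν) : X (ν * μ) = 0 := by
  have := S.HX ν μ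
  rw [h, br_zero] at this
  exact (smul_eq_zero.1 this.symm).resolve_left two_ne_zero
theorem Y_zero {μ} (h : X μ = 0) : Y μ = 0 := by
  have := S.HY μ 1
  rw [S.H_zero h, zero_br, mul_one] at this
  exact (smul_eq_zero.1 (neg_eq_zero.1 this.symm)).resolve_left two_ne_zero

theorem radical [Nontrivial V] (hirr : Irr ρ) (n : R) (hn : X (n ^ 2) = 0) : X n = 0 := by
  have z : ∀ μ ν, X (n * μ * (n * ν)) = 0 := by
    intro μ ν
    rw [show n * μ * (n * ν) = (μ * ν) * n ^ 2 by ring]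
    exact S.X_mul hn _
  have c1 : ∀ μ ν, Commute (X (n * μ)) (Y (n * ν)) := fun μ ν => by
    rw [← br_eq_zero_iff, S.XY, S.H_zero (z _ _)]
  have c2 : ∀ μ ν, Commute (H (n * μ)) (X (n * ν)) := fun μ ν => by
    rw [← br_eq_zero_iff, S.HX, z, smul_zero]
  have c3 : ∀ μ ν, Commute (H (n * μ)) (Y (n * ν)) := fun μ ν => by
    rw [← br_eq_zero_iff, S.HY, S.Y_zero (z _ _), smul_zero, neg_zero]
  have nH : ∀ μ, IsNilpotent (H (n * μ)) := by
    intro μ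
    have h1 := S.uY 1 (n * μ)
    rw [map_one, one_pow, one_mul] at h1
    have h2 : IsNilpotent (Y (n * μ) + H (n * μ) - X (n * μ)) := by
      rw [← h1]
      exact isNilpotent_conj (rho_inv_mul ρ _) (rho_mul_inv ρ _) (S.nY _)
    have h3 : H (n * μ) = (Y (n * μ) + H (n * μ) - X (n * μ)) - (Y (n * μ) - X (n * μ)) := by abel
    rw [h3]
    refine Commute.isNilpotent_sub ?_ h2 (Commute.isNilpotent_sub (c1 _ _).symm (S.nY _) (S.nX _))
    refine Commute.sub_left (Commute.add_left ?_ ?_) ?_ <;> refine Commute.sub_right ?_ ?_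
    · exact Commute.refl _
    · exact (c1 _ _).symm
    · exact c3 _ _
    · exact c2 _ _
    · exact c1 _ _
    · exact Commute.refl _
  set T : Set (Module.End F V) := {f | ∃ μ, f = X (n * μ) ∨ f = Y (n * μ) ∨ f = H (n * μ)} with hT
  have mX : ∀ a μ, X (a * (n * μ)) ∈ Submodule.span F T := fun a μ =>
    Submodule.subset_span ⟨a * μ, Or.inl (by rw [mul_left_comm])⟩
  have mY : ∀ a μ, Y (a * (n * μ)) ∈ Submodule.span F T := fun a μ =>
    Submodule.subset_span ⟨a * μ, Or.inr (Or.inl (by rw [mul_left_comm]))⟩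
  have mH : ∀ a μ, H (a * (n * μ)) ∈ Submodule.span F T := fun a μ =>
    Submodule.subset_span ⟨a * μ, Or.inr (Or.inr (by rw [mul_left_comm]))⟩
  have mX' : ∀ μ, X (n * μ) ∈ Submodule.span F T := fun μ => by simpa using mX 1 μ
  have mY' : ∀ μ, Y (n * μ) ∈ Submodule.span F T := fun μ => by simpa using mY 1 μ
  have mH' : ∀ μ, H (n * μ) ∈ Submodule.span F T := fun μ => by simpa using mH 1 μ
  refine comm_nil_stable_zero ρ hirr T ?_ ?_ ?_ ?_ ?_ _ ⟨1, Or.inl (by rw [mul_one])⟩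
  · rintro _ ⟨μ, rfl | rfl | rfl⟩ _ ⟨ν, rfl | rfl | rfl⟩
    · exact S.cX _ _
    · exact c1 _ _
    · exact (c2 _ _).symm
    · exact (c1 _ _).symm
    · exact S.cY _ _
    · exact (c3 _ _).symm
    · exact c2 _ _
    · exact c3 _ _
    · exact S.HH _ _
  · rintro _ ⟨μ, rfl | rfl | rfl⟩
    · exact S.nX _
    · exact S.nY _
    · exact nH _
  · rintro x _ ⟨μ, rfl | rfl | rfl⟩
    · rw [S.uX]; exact mX' _
    · rw [S.uY]; exact sub_mem (add_mem (mY' _) (mH _ _)) (mX _ _)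
    · rw [S.uH]; exact sub_mem (mH' _) (Submodule.smul_mem _ _ (mX _ _))
  · rintro x _ ⟨μ, rfl | rfl | rfl⟩
    · rw [S.vX]; exact sub_mem (sub_mem (mX' _) (mH _ _)) (mY _ _)
    · rw [S.vY]; exact mY' _
    · rw [S.vH]; exact add_mem (mH' _) (Submodule.smul_mem _ _ (mY _ _))
  · rintro x _ ⟨μ, rfl | rfl | rfl⟩
    · rw [S.dX]; exact mX _ _
    · rw [S.dY]; exact mY _ _
    · rw [S.dH]; exact mH' _

/-- transport along a surjection -/
theorem transport {R' : Type*} [CommRing R'] [Algebra F R'] (π : R →ₐ[F] R') (hπ : Function.Surjective π)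
    (X' Y' H' : R' →ₗ[F] Module.End F V) (hX : ∀ μ, X' (π μ) = X μ) (hY : ∀ μ, Y' (π μ) = Y μ)
    (hH : ∀ μ, H' (π μ) = H μ) : SL2Data ρ ((π : R →* R').comp ι) X' Y' H' := by
  have hι : ∀ x, ((π : R →* R').comp ι) x = π (ι x) := fun x => rfl
  refine ⟨?_, ?_, ?_, ?_, ?_, ?_, ?_, ?_, ?_, ?_, ?_, ?_, ?_, ?_⟩
  · intro μ ν
    obtain ⟨μ, rfl⟩ := hπ μ
    obtain ⟨ν, rfl⟩ := hπ ν
    rw [← map_mul, hX, hY, hH, S.XY]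
  · intro μ ν
    obtain ⟨μ, rfl⟩ := hπ μ
    obtain ⟨ν, rfl⟩ := hπ ν
    rw [← map_mul, hX, hX, hH, S.HX]
  · intro μ ν
    obtain ⟨μ, rfl⟩ := hπ μ
    obtain ⟨ν, rfl⟩ := hπ ν
    rw [← map_mul, hY, hY, hH, S.HY]
  · intro μ ν
    obtain ⟨μ, rfl⟩ := hπ μ
    obtain ⟨ν, rfl⟩ := hπ ν
    rw [hX, hX]; exact S.cX _ _
  · intro μ ν
    obtain ⟨μ, rfl⟩ := hπ μ
    obtain ⟨ν, rfl⟩ := hπ ν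
    rw [hY, hY]; exact S.cY _ _
  · intro μ
    obtain ⟨μ, rfl⟩ := hπ μ
    rw [hX]; exact S.nX _
  · intro μ
    obtain ⟨μ, rfl⟩ := hπ μ
    rw [hY]; exact S.nY _
  · intro x; rw [hι, hX, S.eX]
  · intro x; rw [hι, hY, S.eY]
  · intro x μ
    obtain ⟨μ, rfl⟩ := hπ μ
    rw [hι, ← map_mul, hX, hX, S.dX]
  · intro x μ
    obtain ⟨μ, rfl⟩ := hπ μ
    rw [hι, ← map_mul, hY, hY, S.dY]
  · intro x μ
    obtain ⟨μ, rfl⟩ := hπ μ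
    rw [hι, ← map_pow, ← map_mul, ← map_mul, hY, hX, hH, S.uY]
  · intro x μ
    obtain ⟨μ, rfl⟩ := hπ μ
    rw [hι, ← map_pow, ← map_mul, ← map_mul, hY, hX, hH, S.vX]
  · intro x y
    rw [hι, hι, hι, hX, hX, hX, S.addX]

theorem exists_pi [Nontrivial V] (hirr : Irr ρ) : ∃ (r : ℕ) (φ : Fin r → K →+* F)
    (X' Y' H' : (Fin r → F) →ₗ[F] Module.End F V), SL2Data ρ (MonoidHom.pi (fun s => (φ s : K →* F))) X' Y' H' ∧
      Function.Injective X' := by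
  let I : Ideal R :=
    { carrier := {μ | X μ = 0}
      add_mem' := by
        intro a b ha hb
        simp only [Set.mem_ofPred_eq] at *
        rw [map_add, ha, hb, add_zero]
      zero_mem' := by simp
      smul_mem' := fun c x hx => S.X_mul hx c }
  have hI : ∀ μ, μ ∈ I ↔ X μ = 0 := fun μ => Iff.rfl
  have hle : ∀ μ, μ ∈ I.restrictScalars F ↔ X μ = 0 := fun μ => Iff.rfl
  have hred : IsReduced (R ⧸ I) := by
    rw [isReduced_iff_pow_one_lt 2 (by norm_num)]
    intro x hx
    obtain ⟨x, rfl⟩ := Ideal.Quotient.mk_surjective x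
    rw [← map_pow, Ideal.Quotient.eq_zero_iff_mem, hI] at hx
    rw [Ideal.Quotient.eq_zero_iff_mem, hI]
    exact S.radical hirr x hx
  let XQ : (R ⧸ I) →ₗ[F] Module.End F V := Submodule.liftQ (I.restrictScalars F) X (fun μ h => h)
  let YQ : (R ⧸ I) →ₗ[F] Module.End F V := Submodule.liftQ (I.restrictScalars F) Y (fun μ h => S.Y_zero h)
  let HQ : (R ⧸ I) →ₗ[F] Module.End F V := Submodule.liftQ (I.restrictScalars F) H (fun μ h => S.H_zero h)
  have hXQ : Function.Injective XQ := by
    rw [← LinearMap.ker_eq_bot, LinearMap.ker_eq_bot']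
    intro x hx
    obtain ⟨x, rfl⟩ := Ideal.Quotient.mk_surjective x
    rw [Ideal.Quotient.eq_zero_iff_mem, hI]
    exact hx
  have hfin : Module.Finite F (R ⧸ I) := Module.Finite.of_injective XQ hXQ
  have hart : IsArtinianRing (R ⧸ I) := IsArtinianRing.of_finite F (R ⧸ I)
  have hbij : ∀ m : MaximalSpectrum (R ⧸ I), Function.Bijective (algebraMap F ((R ⧸ I) ⧸ m.asIdeal)) := by
    intro m
    have := m.isMaximal
    have : IsDomain ((R ⧸ I) ⧸ m.asIdeal) := Ideal.Quotient.isDomain _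
    exact IsAlgClosed.algebraMap_bijective_of_isIntegral
  have hfinm : Finite (MaximalSpectrum (R ⧸ I)) := inferInstance
  obtain ⟨r, ⟨eq⟩⟩ := Finite.exists_equiv_fin (MaximalSpectrum (R ⧸ I))
  let ψ : ∀ m : MaximalSpectrum (R ⧸ I), ((R ⧸ I) ⧸ m.asIdeal) ≃ₐ[F] F := fun m =>
    (AlgEquiv.ofBijective (Algebra.ofId F _) (hbij m)).symm
  let θ : (R ⧸ I) →ₐ[F] (Fin r → F) := AlgHom.pi fun s =>
    ((ψ (eq.symm s)) : _ →ₐ[F] F).comp (Ideal.Quotient.mkₐ F (eq.symm s).asIdeal)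
  have hθ : Function.Bijective θ := by
    constructor
    · intro a b hab
      apply (IsArtinianRing.equivPi (R ⧸ I)).injective
      ext m
      have := congrFun hab (eq m)
      have h2 : ψ (eq.symm (eq m)) (Ideal.Quotient.mk _ a) = ψ (eq.symm (eq m)) (Ideal.Quotient.mk _ b) := this
      have h3 := (ψ _).injective h2
      rw [eq.symm_apply_apply] at h3
      exact h3
    · intro f
      obtain ⟨a, ha⟩ := (IsArtinianRing.equivPi (R ⧸ I)).surjective (fun m => (ψ m).symm (f (eq m)))
      refine ⟨a, ?_⟩
      ext s
      have h1 := congrFun ha (eq.symm s)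
      change Ideal.Quotient.mk _ a = _ at h1
      change ψ (eq.symm s) (Ideal.Quotient.mk _ a) = _
      rw [h1, AlgEquiv.apply_symm_apply, eq.apply_symm_apply]
  let Θ := AlgEquiv.ofBijective θ hθ
  have S' := S.transport (Θ.toAlgHom.comp (Ideal.Quotient.mkₐ F I))
    (Θ.surjective.comp Ideal.Quotient.mk_surjective)
    (XQ.comp Θ.symm.toLinearMap) (YQ.comp Θ.symm.toLinearMap) (HQ.comp Θ.symm.toLinearMap)
    (fun μ => by
      change XQ (Θ.symm (Θ (Ideal.Quotient.mk I μ))) = _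
      rw [AlgEquiv.symm_apply_apply]; rfl)
    (fun μ => by
      change YQ (Θ.symm (Θ (Ideal.Quotient.mk I μ))) = _
      rw [AlgEquiv.symm_apply_apply]; rfl)
    (fun μ => by
      change HQ (Θ.symm (Θ (Ideal.Quotient.mk I μ))) = _
      rw [AlgEquiv.symm_apply_apply]; rfl)
  have hinj : Function.Injective (XQ.comp Θ.symm.toLinearMap) := hXQ.comp Θ.symm.injective
  set ι' := ((Θ.toAlgHom.comp (Ideal.Quotient.mkₐ F I) : R →ₐ[F] (Fin r → F)) : R →* (Fin r → F)).comp ι with hι'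
  have hadd : ∀ x y, ι' (x + y) = ι' x + ι' y := by
    intro x y
    apply hinj
    rw [S'.addX, map_add]
  have h0 : ι' 0 = 0 := by have := hadd 0 0; simpa using this
  refine ⟨r, fun s => ⟨⟨⟨fun x => ι' x s, by simp⟩, by simp⟩, by simp [h0], by simp [hadd]⟩, _, _, _, S', hinj⟩
end SL2Data
end P5


set_option linter.unusedSectionVars false
section sl2
variable {F V : Type*} [Field F] [CharZero F] [AddCommGroup V] [Module F V]

theorem H_pow_Y {Y H : Module.End F V} (hHY : br H Y = -((2 : F) • Y)) {w : V} {μ : F}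
    (hw : H w = μ • w) (m : ℕ) : H ((Y ^ m) w) = (μ - 2 * m) • (Y ^ m) w := by
  have h1 : ∀ z, H (Y z) = Y (H z) - (2 : F) • Y z := by
    intro z
    have := congrArg (fun f : Module.End F V => f z) hHY
    simp only [br, LinearMap.sub_apply, Module.End.mul_apply, LinearMap.neg_apply, LinearMap.smul_apply] at this
    rw [sub_eq_iff_eq_add] at this
    rw [this]; abel
  induction m with
  | zero => simp [hw]
  | succ m ih =>
    rw [pow_succ', Module.End.mul_apply, h1, ih, map_smul, ← sub_smul]
    congr 1; push_cast; ring

theorem X_pow_Y {X Y H : Module.End F V} (hXY : br X Y = H) (hHY : br H Y = -((2 : F) • Y)) {w : V} {μ : F}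
    (hX : X w = 0) (hw : H w = μ • w) (m : ℕ) :
    X ((Y ^ (m + 1)) w) = (((m : F) + 1) * (μ - m)) • (Y ^ m) w := by
  have h1 : ∀ z, X (Y z) = Y (X z) + H z := by
    intro z
    have := congrArg (fun f : Module.End F V => f z) hXY
    simp only [br, LinearMap.sub_apply, Module.End.mul_apply] at this
    rw [← this]; abel
  induction m with
  | zero => simp [h1, hX, hw]
  | succ m ih =>
    rw [pow_succ', Module.End.mul_apply, h1, ih, map_smul, ← Module.End.mul_apply Y, ← pow_succ',
      H_pow_Y hHY hw, ← add_smul]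
    congr 1; push_cast; ring

theorem exists_weight {X Y H : Module.End F V} (hXY : br X Y = H) (hHY : br H Y = -((2 : F) • Y)) {w : V} {μ : F}
    (hX : X w = 0) (hw : H w = μ • w) (hY : IsNilpotent Y) (hw0 : w ≠ 0) :
    ∃ n : ℕ, μ = n ∧ (Y ^ (n + 1)) w = 0 := by
  classical
  obtain ⟨k, hk⟩ := hY
  have hex : ∃ k, (Y ^ k) w = 0 := ⟨k, by simp [hk]⟩
  obtain ⟨m, hm⟩ : ∃ m, Nat.find hex = m + 1 := by
    apply Nat.exists_eq_succ_of_ne_zero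
    intro h
    have := Nat.find_spec hex
    rw [h] at this
    exact hw0 (by simpa using this)
  have h1 : (Y ^ (m + 1)) w = 0 := by rw [← hm]; exact Nat.find_spec hex
  have h2 : (Y ^ m) w ≠ 0 := Nat.find_min hex (by omega)
  have h3 := X_pow_Y hXY hHY hX hw m
  rw [h1, map_zero] at h3
  have h4 := (smul_eq_zero.1 h3.symm).resolve_right h2
  have h5 : (m : F) + 1 ≠ 0 := by exact_mod_cast Nat.succ_ne_zero m
  exact ⟨m, sub_eq_zero.1 ((mul_eq_zero.1 h4).resolve_left h5), h1⟩

theorem Y_pow_zero {X Y H : Module.End F V} (hXY : br X Y = H) (hHY : br H Y = -((2 : F) • Y)) {w : V} {n : ℕ}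
    (hX : X w = 0) (hw : H w = (n : F) • w) (hY : IsNilpotent Y) (m : ℕ) (hm : n < m) : (Y ^ m) w = 0 := by
  by_cases hw0 : w = 0
  · simp [hw0]
  obtain ⟨k, h1, h2⟩ := exists_weight hXY hHY hX hw hY hw0
  have : n = k := by exact_mod_cast h1
  subst this
  obtain ⟨j, rfl⟩ := Nat.exists_eq_add_of_le (Nat.succ_le_of_lt hm)
  rw [Nat.succ_eq_add_one, add_comm, pow_add, Module.End.mul_apply, h2, map_zero]

theorem X_pow_Y_pow {X Y H : Module.End F V} (hXY : br X Y = H) (hHY : br H Y = -((2 : F) • Y)) {w : V} {n : ℕ}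
    (hX : X w = 0) (hw : H w = (n : F) • w) (a k : ℕ) (hak : a + k = n) (j : ℕ) :
    (X ^ j) ((Y ^ k) w) = ((k.descFactorial j : F) * ((a + 1).ascFactorial j : F)) • (Y ^ (k - j)) w := by
  induction j with
  | zero => simp
  | succ j ih =>
    rw [pow_succ', Module.End.mul_apply, ih, map_smul]
    rcases Nat.lt_or_ge j k with h | h
    · obtain ⟨m, rfl⟩ : ∃ m, k = j + (m + 1) := ⟨k - j - 1, by omega⟩
      rw [show j + (m + 1) - j = m + 1 by omega, X_pow_Y hXY hHY hX hw, smul_smul,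
        show j + (m + 1) - (j + 1) = m by omega]
      congr 1
      rw [Nat.descFactorial_succ, Nat.ascFactorial_succ, show j + (m + 1) - j = m + 1 by omega, ← hak]
      push_cast; ring
    · rw [show k - j = 0 by omega, Nat.descFactorial_of_lt (by omega : k < j + 1)]
      simp [hX]

end sl2


set_option linter.unusedSectionVars false
section P7
variable {F V : Type*} [Field F] [CharZero F] [AddCommGroup V] [Module F V]

/-- linear substitution -/
noncomputable def sub2 (M : Matrix (Fin 2) (Fin 2) F) : MvPolynomial (Fin 2) F →ₐ[F] MvPolynomial (Fin 2) F :=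
  MvPolynomial.aeval (fun i : Fin 2 => ∑ j : Fin 2, C (M j i) * X j)

theorem sub2_X (M : Matrix (Fin 2) (Fin 2) F) (i : Fin 2) : sub2 M (X i) = C (M 0 i) * X 0 + C (M 1 i) * X 1 := by
  rw [sub2, aeval_X, Fin.sum_univ_two]

theorem sub2_C (M : Matrix (Fin 2) (Fin 2) F) (c : F) : sub2 M (C c) = C c := by
  rw [sub2, aeval_C]; rfl

theorem sub2_mul (M N : Matrix (Fin 2) (Fin 2) F) (p) : sub2 (M * N) p = sub2 M (sub2 N p) := by
  have : sub2 (M * N) = (sub2 M).comp (sub2 N) := by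
    apply MvPolynomial.algHom_ext
    intro i
    rw [AlgHom.comp_apply, sub2_X, sub2_X, map_add, map_mul, map_mul, sub2_C, sub2_C, sub2_X, sub2_X,
      Matrix.mul_apply, Matrix.mul_apply, Fin.sum_univ_two, Fin.sum_univ_two]
    simp only [map_add, map_mul]
    ring
  rw [this, AlgHom.comp_apply]

theorem symPow_val (n : ℕ) (M : Matrix (Fin 2) (Fin 2) F) (p : homogeneousSubmodule (Fin 2) F n) :
    (symPow n M p : MvPolynomial (Fin 2) F) = sub2 M (p : MvPolynomial (Fin 2) F) := by
  have h : (sub2 M (p : MvPolynomial (Fin 2) F)).IsHomogeneous n := by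
    have := MvPolynomial.IsHomogeneous.aeval ((mem_homogeneousSubmodule _ _).1 p.2)
      (fun i : Fin 2 => ∑ j : Fin 2, C (M j i) * X j) (n := 1) (fun i => by
        apply IsHomogeneous.sum
        intro j _
        exact (isHomogeneous_C_mul_X _ _))
    rw [one_mul] at this
    exact this
  exact homogeneousComponent_eq_self h

theorem symPow_mul (n : ℕ) (M N : Matrix (Fin 2) (Fin 2) F) :
    symPow n (M * N) = (symPow n M).comp (symPow n N) := by
  ext1 p
  apply Subtype.ext
  rw [LinearMap.comp_apply, symPow_val, symPow_val, symPow_val, sub2_mul]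

theorem hom_induction (n : ℕ) (P : MvPolynomial (Fin 2) F → Prop) (h0 : P 0)
    (hadd : ∀ p q, P p → P q → P (p + q)) (hsm : ∀ (c : F) p, P p → P (c • p))
    (h : ∀ a k, a + k = n → P (X 0 ^ a * X 1 ^ k)) (p : MvPolynomial (Fin 2) F)
    (hp : p ∈ homogeneousSubmodule (Fin 2) F n) : P p := by
  rw [mem_homogeneousSubmodule] at hp
  rw [p.as_sum]
  apply Finset.sum_induction _ P hadd h0
  intro d hd
  have hd' := hp (mem_support_iff.1 hd)
  have h1 : monomial d (coeff d p) = coeff d p • (X 0 ^ (d 0) * X 1 ^ (d 1)) := by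
    rw [MvPolynomial.monomial_eq, MvPolynomial.smul_eq_C_mul, Finsupp.prod_fintype _ _ (by simp)]
    simp [Fin.prod_univ_two]
  rw [h1]
  apply hsm
  apply h
  rw [← hd', Finsupp.weight_apply, Finsupp.sum_fintype _ _ (by simp)]
  simp [Fin.sum_univ_two]

/-- the basic map from polynomials to operators -/
noncomputable def psiL (n : ℕ) (Y : Module.End F V) : MvPolynomial (Fin 2) F →ₗ[F] Module.End F V :=
  (basisMonomials (Fin 2) F).constr F (fun d => ((d 0).factorial / n.factorial : F) • Y ^ (d 1))

theorem psiL_apply (n : ℕ) (Y : Module.End F V) (a k : ℕ) :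
    psiL n Y (X 0 ^ a * X 1 ^ k) = ((a.factorial / n.factorial : F)) • Y ^ k := by
  have h1 : (X 0 ^ a * X 1 ^ k : MvPolynomial (Fin 2) F) = basisMonomials (Fin 2) F (Finsupp.single 0 a + Finsupp.single 1 k) := by
    rw [coe_basisMonomials, X_pow_eq_monomial, X_pow_eq_monomial, monomial_mul, one_mul]
  rw [h1, psiL, Module.Basis.constr_basis]
  simp

theorem psiL_commute (n : ℕ) (Y A : Module.End F V) (h : Commute A Y) (p) : Commute A (psiL n Y p) := by
  induction p using MvPolynomial.induction_on' with
  | monomial d c =>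
    have h1 : monomial d c = c • basisMonomials (Fin 2) F d := by
      rw [coe_basisMonomials, smul_monomial]; simp
    rw [h1, map_smul, psiL, Module.Basis.constr_basis]
    exact ((h.pow_right _).smul_right _).smul_right _
  | add p q hp hq => rw [map_add]; exact hp.add_right hq

theorem psiL_dd (n : ℕ) (Y D D' : Module.End F V) (b : F) (h1 : D' * D = 1) (h2 : D * D' = 1)
    (h : D * Y * D' = b • Y) (p : homogeneousSubmodule (Fin 2) F n) :
    D * psiL n Y p * D' = psiL n Y (symPow n !![1, 0; 0, b] p) := by
  rw [symPow_val]
  refine hom_induction n (fun p => D * psiL n Y p * D' = psiL n Y (sub2 !![1, 0; 0, b] p)) ?_ ?_ ?_ ?_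
    (p : MvPolynomial (Fin 2) F) p.2
  · simp
  · intro p q hp hq
    simp only [map_add, mul_add, add_mul, hp, hq]
  · intro c p hp
    simp only [map_smul, mul_smul_comm, smul_mul_assoc, hp]
  intro a k _
  rw [psiL_apply]
  simp only [map_mul, map_pow, sub2_X]
  simp only [Matrix.cons_val', Matrix.cons_val_zero, Matrix.cons_val_one, Matrix.of_apply, Matrix.cons_val_fin_one,
    map_one, map_zero, one_mul, zero_mul, add_zero, zero_add]
  rw [mul_pow, ← map_pow, mul_left_comm, ← MvPolynomial.smul_eq_C_mul, map_smul, psiL_apply, mul_smul_comm,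
    smul_mul_assoc, ← pow_conj h1 h2, h, smul_pow, smul_smul, smul_smul, mul_comm]

theorem psiL_uu (n : ℕ) {X' Y H : Module.End F V} (hXY : br X' Y = H) (hHY : br H Y = -((2 : F) • Y))
    (hXn : IsNilpotent X') {w : V}
    (hX : X' w = 0) (hw : H w = (n : F) • w) (t : F) (p : homogeneousSubmodule (Fin 2) F n) :
    nexp F (t • X') (psiL n Y p w) = psiL n Y (symPow n !![1, t; 0, 1] p) w := by
  rw [symPow_val]
  refine hom_induction n (fun p => nexp F (t • X') (psiL n Y p w) = psiL n Y (sub2 !![1, t; 0, 1] p) w) ?_ ?_ ?_ ?_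
    (p : MvPolynomial (Fin 2) F) p.2
  · simp
  · intro p q hp hq
    simp only [map_add, LinearMap.add_apply, hp, hq]
  · intro c p hp
    simp only [map_smul, LinearMap.smul_apply, hp]
  intro a k hak
  simp only [psiL_apply]
  simp only [map_mul, map_pow, sub2_X]
  simp only [Matrix.cons_val', Matrix.cons_val_zero, Matrix.cons_val_one, Matrix.of_apply, Matrix.cons_val_fin_one,
    map_one, map_zero, one_mul, zero_mul, add_zero, zero_add]
  obtain ⟨N, hN⟩ := hXn
  have hN' : X' ^ (N + k + 1) = 0 := pow_eq_zero_of_le (by omega) hN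
  rw [nexp_smul_eq_sum hN', add_pow, Finset.mul_sum, map_sum, LinearMap.sum_apply, LinearMap.sum_apply]
  have hn : (n.factorial : F) ≠ 0 := by exact_mod_cast n.factorial_ne_zero
  rw [← Finset.sum_subset (Finset.range_subset_range.2 (by omega : k + 1 ≤ N + k + 1))]
  · apply Finset.sum_congr rfl
    intro j hj
    have hj' : j ≤ k := by simp at hj; omega
    have e : (X 0 ^ a * ((C t * X 0) ^ j * X 1 ^ (k - j) * (k.choose j : MvPolynomial (Fin 2) F))) =
      ((t ^ j * k.choose j : F)) • (X 0 ^ (a + j) * X 1 ^ (k - j) : MvPolynomial (Fin 2) F) := by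
      rw [MvPolynomial.smul_eq_C_mul, map_mul, map_pow, map_natCast, mul_pow, pow_add]; ring
    rw [e, map_smul, psiL_apply, LinearMap.smul_apply, LinearMap.smul_apply, LinearMap.smul_apply,
      LinearMap.smul_apply, LinearMap.smul_apply, map_smul, X_pow_Y_pow hXY hHY hX hw a k hak]
    simp only [smul_smul]
    congr 1
    have h1 : (j.factorial : F) ≠ 0 := by exact_mod_cast j.factorial_ne_zero
    have h2 : ((k.descFactorial j : ℕ) : F) = j.factorial * k.choose j := by
      rw [Nat.descFactorial_eq_factorial_mul_choose]; push_cast; ring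
    have h3 : (a.factorial : F) * ((a + 1).ascFactorial j : ℕ) = (a + j).factorial := by
      rw [← Nat.factorial_mul_ascFactorial]; push_cast; ring
    rw [← h3, h2]
    field_simp
  · intro j _ hj
    have hj' : k < j := by simp at hj; omega
    rw [LinearMap.smul_apply, LinearMap.smul_apply, LinearMap.smul_apply, map_smul,
      X_pow_Y_pow hXY hHY hX hw a k hak, Nat.descFactorial_of_lt hj']
    simp

theorem psiL_vv (n : ℕ) {X' Y H : Module.End F V} (hXY : br X' Y = H) (hHY : br H Y = -((2 : F) • Y))
    (hYn : IsNilpotent Y) {w : V}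
    (hX : X' w = 0) (hw : H w = (n : F) • w) (t : F) (p : homogeneousSubmodule (Fin 2) F n) :
    nexp F (t • Y) (psiL n Y p w) = psiL n Y (symPow n !![1, 0; t, 1] p) w := by
  rw [symPow_val]
  refine hom_induction n (fun p => nexp F (t • Y) (psiL n Y p w) = psiL n Y (sub2 !![1, 0; t, 1] p) w) ?_ ?_ ?_ ?_
    (p : MvPolynomial (Fin 2) F) p.2
  · simp
  · intro p q hp hq
    simp only [map_add, LinearMap.add_apply, hp, hq]
  · intro c p hp
    simp only [map_smul, LinearMap.smul_apply, hp]
  intro a k hak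
  simp only [psiL_apply]
  simp only [map_mul, map_pow, sub2_X]
  simp only [Matrix.cons_val', Matrix.cons_val_zero, Matrix.cons_val_one, Matrix.of_apply, Matrix.cons_val_fin_one,
    map_one, map_zero, one_mul, zero_mul, add_zero, zero_add]
  have hY0 := Y_pow_zero hXY hHY hX hw hYn
  obtain ⟨N, hN⟩ := hYn
  have hN' : Y ^ (N + a + 1) = 0 := pow_eq_zero_of_le (by omega) hN
  rw [nexp_smul_eq_sum hN', add_comm (X 0 : MvPolynomial (Fin 2) F), add_pow, Finset.sum_mul, map_sum, LinearMap.sum_apply, LinearMap.sum_apply]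
  have hn : (n.factorial : F) ≠ 0 := by exact_mod_cast n.factorial_ne_zero
  rw [← Finset.sum_subset (Finset.range_subset_range.2 (by omega : a + 1 ≤ N + a + 1))]
  · apply Finset.sum_congr rfl
    intro j hj
    have hj' : j ≤ a := by simp at hj; omega
    have e : ((C t * X 1) ^ j * X 0 ^ (a - j) * (a.choose j : MvPolynomial (Fin 2) F)) * X 1 ^ k =
      ((t ^ j * a.choose j : F)) • (X 0 ^ (a - j) * X 1 ^ (j + k) : MvPolynomial (Fin 2) F) := by
      rw [MvPolynomial.smul_eq_C_mul, map_mul, map_pow, map_natCast, mul_pow, pow_add]; ring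
    rw [e, map_smul, psiL_apply, LinearMap.smul_apply, LinearMap.smul_apply, LinearMap.smul_apply,
      LinearMap.smul_apply, LinearMap.smul_apply, map_smul, ← Module.End.mul_apply, ← pow_add]
    simp only [smul_smul]
    congr 1
    have h1 : (j.factorial : F) ≠ 0 := by exact_mod_cast j.factorial_ne_zero
    have h2 : (a.choose j : F) * j.factorial * (a - j).factorial = a.factorial := by
      exact_mod_cast Nat.choose_mul_factorial_mul_factorial hj'
    rw [← h2]
    field_simp
  · intro j _ hj
    have hj' : a < j := by simp at hj; omega
    rw [LinearMap.smul_apply, LinearMap.smul_apply, LinearMap.smul_apply, map_smul, ← Module.End.mul_apply, ← pow_add,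
      hY0 _ (by omega)]
    simp
end P7



set_option linter.unusedSectionVars false
section P8
variable {K F V : Type*} [Field K] [CharZero K] [Field F] [CharZero F] [IsAlgClosed F] [AddCommGroup V] [Module F V]
  [FiniteDimensional F V]

/-- split data together with a highest weight vector -/
structure SplitData (ρ : GL (Fin 2) K →* Module.End F V) {r : ℕ} (φ : Fin r → K →+* F) (n : Fin r → ℕ)
    (f : Kˣ →* Fˣ) (X Y H : Fin r → Module.End F V) (v : V) : Prop where
  XY : ∀ s, br (X s) (Y s) = H s
  HX : ∀ s, br (H s) (X s) = (2 : F) • X s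
  HY : ∀ s, br (H s) (Y s) = -((2 : F) • Y s)
  XYc : ∀ s t, s ≠ t → Commute (X s) (Y t)
  HXc : ∀ s t, s ≠ t → Commute (H s) (X t)
  HYc : ∀ s t, s ≠ t → Commute (H s) (Y t)
  cX : ∀ s t, Commute (X s) (X t)
  cY : ∀ s t, Commute (Y s) (Y t)
  cH : ∀ s t, Commute (H s) (H t)
  nX : ∀ s, IsNilpotent (X s)
  nY : ∀ s, IsNilpotent (Y s)
  eX : ∀ x : K, ρ (uu x) = nexp F (∑ s, φ s x • X s)
  eY : ∀ x : K, ρ (vv x) = nexp F (∑ s, φ s x • Y s)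
  dY : ∀ (b : Kˣ) s, ρ (dd b) * Y s * ρ (dd b)⁻¹ = φ s b • Y s
  X0 : ∀ s, X s ≠ 0
  v0 : v ≠ 0
  Xv : ∀ s, X s v = 0
  Hv : ∀ s, H s v = (n s : F) • v
  dv : ∀ b, ρ (dd b) v = ((f b : Fˣ) : F) • v

theorem exists_split [Nontrivial V] (ρ : GL (Fin 2) K →* Module.End F V) (hirr : Irr ρ) :
    ∃ (r : ℕ) (φ : Fin r → K →+* F) (n : Fin r → ℕ) (f : Kˣ →* Fˣ) (X Y H : Fin r → Module.End F V) (v : V),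
      SplitData ρ φ n f X Y H v := by
  obtain ⟨X0, Y0, L⟩ := exists_logData ρ
  obtain ⟨r, φ, X', Y', H', S, hinj⟩ := (L.toSL2 hirr).exists_pi hirr
  have hss : ∀ s t : Fin r, s ≠ t → (Pi.single s (1 : F) : Fin r → F) * Pi.single t 1 = 0 := by
    intro s t hst
    ext i
    by_cases h : i = s
    · subst h; simp [hst]
    · simp [h]
  have hs1 : ∀ s : Fin r, (Pi.single s (1 : F) : Fin r → F) * Pi.single s 1 = Pi.single s 1 := by
    intro s
    rw [← Pi.single_mul, one_mul]
  have hdec : ∀ (Z : (Fin r → F) →ₗ[F] Module.End F V) (x : Fin r → F), Z x = ∑ s, x s • Z (Pi.single s 1) := by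
    intro Z x
    conv_lhs => rw [pi_eq_sum_univ' x]
    rw [map_sum]
    apply Finset.sum_congr rfl
    intro s _
    rw [map_smul]
  have hms : ∀ (x : Fin r → F) (s : Fin r), x * Pi.single s 1 = x s • Pi.single s 1 := by
    intro x s
    ext i
    by_cases h : i = s
    · subst h; simp
    · simp [h]
  have hdX : ∀ (b : Kˣ) s, ρ (dd b) * X' (Pi.single s 1) = (φ s (b : K)⁻¹) • (X' (Pi.single s 1) * ρ (dd b)) := by
    intro b s
    have h := S.dX b (Pi.single s 1)
    rw [hms, map_smul] at h
    have h2 := congrArg (· * ρ (dd b)) h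
    simp only [mul_assoc, rho_inv_mul, mul_one, smul_mul_assoc] at h2
    exact h2
  have hdH : ∀ (b : Kˣ) s, Commute (ρ (dd b)) (H' (Pi.single s 1)) := by
    intro b s
    have h := S.dH b (Pi.single s 1)
    have h2 := congrArg (· * ρ (dd b)) h
    simp only [mul_assoc, rho_inv_mul, mul_one] at h2
    exact h2
  have hdd : ∀ a b : Kˣ, Commute (ρ (dd a)) (ρ (dd b)) := by
    intro a b
    unfold Commute SemiconjBy
    rw [← map_mul, ← map_mul, ← dd_mul, ← dd_mul, mul_comm]
  -- kernel of all X
  let W₀ : Submodule F V := ⨅ s, LinearMap.ker (X' (Pi.single s 1))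
  have hmem : ∀ w, w ∈ W₀ ↔ ∀ s, X' (Pi.single s 1) w = 0 := by
    intro w; simp [W₀, Submodule.mem_iInf]
  have hW₀ : W₀ ≠ ⊥ := by
    obtain ⟨v, -, hv0, hv⟩ := exists_common_eigenvector (Set.range fun s => X' (Pi.single s (1 : F)))
      (by rintro _ ⟨s, rfl⟩ _ ⟨t, rfl⟩; exact S.cX _ _) ⊤ top_ne_bot (by simp)
    intro h
    apply hv0
    rw [← Submodule.mem_bot F, ← h, hmem]
    intro s
    obtain ⟨μ, hμ⟩ := hv _ ⟨s, rfl⟩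
    rw [hμ, eigenvalue_zero_of_nilpotent _ (S.nX _) v hv0 μ hμ, zero_smul]
  obtain ⟨v, hvW, hv0, hv⟩ := exists_common_eigenvector
    ((Set.range fun s => H' (Pi.single s (1 : F))) ∪ Set.range fun b => ρ (dd b))
    (by
      rintro _ (⟨s, rfl⟩ | ⟨s, rfl⟩) _ (⟨t, rfl⟩ | ⟨t, rfl⟩)
      · exact S.HH _ _
      · exact (hdH _ _).symm
      · exact hdH _ _
      · exact hdd _ _) W₀ hW₀ (by
      rintro _ (⟨s, rfl⟩ | ⟨s, rfl⟩) w hw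
      · rw [hmem] at hw ⊢
        intro t
        have h := congrArg (fun f : Module.End F V => f w) (S.HX (Pi.single s 1) (Pi.single t 1))
        simp only [br, LinearMap.sub_apply, Module.End.mul_apply, hw, map_zero, zero_sub, LinearMap.smul_apply] at h
        by_cases hst : s = t
        · subst hst
          rw [hs1, hw, smul_zero, neg_eq_zero] at h
          exact h
        · rw [hss _ _ hst, map_zero, LinearMap.zero_apply, smul_zero, neg_eq_zero] at h
          exact h
      · rw [hmem] at hw ⊢
        intro t
        have h := congrArg (fun f : Module.End F V => f w) (hdX s t)
        simp only [Module.End.mul_apply, hw, map_zero, LinearMap.smul_apply] at h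
        refine (smul_eq_zero.1 h.symm).resolve_left ?_
        simp)
  rw [hmem] at hvW
  choose μ hμ using fun s => hv _ (Or.inl ⟨s, rfl⟩)
  choose c hc using fun b => hv _ (Or.inr ⟨b, rfl⟩)
  beta_reduce at hμ hc
  have hXY : ∀ s, br (X' (Pi.single s 1)) (Y' (Pi.single s 1)) = H' (Pi.single s 1) := by
    intro s; rw [S.XY, hs1]
  have hHY : ∀ s, br (H' (Pi.single s 1)) (Y' (Pi.single s 1)) = -((2 : F) • Y' (Pi.single s 1)) := by
    intro s; rw [S.HY, hs1]
  choose n hn _ using fun s => exists_weight (hXY s) (hHY s) (hvW s) (hμ s) (S.nY _) hv0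
  have hc1 : c 1 = 1 := by
    have h := hc 1
    have : dd (1 : Kˣ) = 1 := by
      have := dd_mul (1 : Kˣ) 1
      rw [mul_one] at this
      exact (mul_eq_left.1 this.symm)
    rw [this, map_one, Module.End.one_apply] at h
    exact (smul_left_injective F hv0 (by simpa using h)).symm
  have hcm : ∀ a b, c (a * b) = c a * c b := by
    intro a b
    apply smul_left_injective F hv0
    show c (a * b) • v = (c a * c b) • v
    rw [← hc, dd_mul, map_mul, Module.End.mul_apply, hc, map_smul, hc, smul_smul, mul_comm]
  let c' : Kˣ →* F := ⟨⟨c, hc1⟩, hcm⟩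
  refine ⟨r, φ, n, c'.toHomUnits, fun s => X' (Pi.single s 1), fun s => Y' (Pi.single s 1), fun s => H' (Pi.single s 1), v,
    hXY, ?_, hHY, ?_, ?_, ?_, fun s t => S.cX _ _, fun s t => S.cY _ _, fun s t => S.HH _ _, fun s => S.nX _, fun s => S.nY _,
    ?_, ?_, ?_, ?_, hv0, hvW, ?_, ?_⟩
  · intro s; rw [S.HX, hs1]
  · intro s t hst; rw [← br_eq_zero_iff, S.XY, hss _ _ hst, map_zero]
  · intro s t hst; rw [← br_eq_zero_iff, S.HX, hss _ _ hst, map_zero, smul_zero]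
  · intro s t hst; rw [← br_eq_zero_iff, S.HY, hss _ _ hst, map_zero, smul_zero, neg_zero]
  · intro x; rw [S.eX, hdec]; rfl
  · intro x; rw [S.eY, hdec]; rfl
  · intro b s
    have h := S.dY b (Pi.single s 1)
    rw [hms, map_smul] at h
    exact h
  · intro s h
    have := hinj (h.trans (map_zero X').symm)
    simpa using congrFun this s
  · intro s; rw [hμ, hn]
  · intro b; rw [hc]; rfl
end P8



set_option linter.unusedSectionVars false
section P9a
variable {F V ι A : Type*} [Field F] [CharZero F] [AddCommGroup V] [Module F V] [Ring A] [Algebra F A]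

theorem nexp_list_sum (Z : ι → A) (hc : ∀ s t, Commute (Z s) (Z t)) (hn : ∀ s, IsNilpotent (Z s)) (l : List ι) :
    IsNilpotent (l.map Z).sum ∧ nexp F (l.map Z).sum = (l.map fun s => nexp F (Z s)).prod := by
  induction l with
  | nil => simp [nexp_zero]
  | cons a l ih =>
    have hcm : Commute (Z a) (l.map Z).sum := by
      apply Commute.list_sum_right
      intro b hb
      obtain ⟨t, _, rfl⟩ := List.mem_map.1 hb
      exact hc _ _
    rw [List.map_cons, List.map_cons, List.sum_cons, List.prod_cons]
    exact ⟨hcm.isNilpotent_add (hn a) ih.1, by rw [nexp_add hcm (hn a) ih.1, ih.2]⟩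

theorem list_prod_mul (E P : ι → A) (h : ∀ s t, s ≠ t → Commute (E s) (P t)) (l : List ι) (hl : l.Nodup) :
    (l.map E).prod * (l.map P).prod = (l.map fun s => E s * P s).prod := by
  induction l with
  | nil => simp
  | cons a l ih =>
    rw [List.nodup_cons] at hl
    have hcm : Commute (l.map E).prod (P a) := by
      apply Commute.list_prod_left
      intro b hb
      obtain ⟨t, ht, rfl⟩ := List.mem_map.1 hb
      exact h _ _ (fun e => hl.1 (e ▸ ht))
    simp only [List.map_cons, List.prod_cons]
    rw [← ih hl.2, mul_assoc, ← mul_assoc _ (P a), hcm.eq]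
    simp only [mul_assoc]

theorem list_comm (B : ι → Module.End F V) (Z : Module.End F V) (l : List ι) (h : ∀ t ∈ l, Commute Z (B t)) (v : V) :
    Z ((l.map B).prod v) = (l.map B).prod (Z v) := by
  have hcm : Commute Z (l.map B).prod := by
    apply Commute.list_prod_right
    intro b hb
    obtain ⟨t, ht, rfl⟩ := List.mem_map.1 hb
    exact h t ht
  rw [← Module.End.mul_apply, hcm.eq, Module.End.mul_apply]

theorem list_mem_U (B : ι → Module.End F V) (X H : ι → Module.End F V) (n : ι → ℕ)
    (hX : ∀ s t, s ≠ t → Commute (X s) (B t)) (hH : ∀ s t, s ≠ t → Commute (H s) (B t)) (v : V)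
    (hXv : ∀ s, X s v = 0) (hHv : ∀ s, H s v = (n s : F) • v) (l : List ι) (s : ι) (hs : s ∉ l) :
    X s ((l.map B).prod v) = 0 ∧ H s ((l.map B).prod v) = (n s : F) • (l.map B).prod v := by
  have hne : ∀ t ∈ l, s ≠ t := fun t ht e => hs (e ▸ ht)
  rw [list_comm _ _ _ (fun t ht => hX s t (hne t ht)), list_comm _ _ _ (fun t ht => hH s t (hne t ht)), hXv, hHv, map_zero,
    map_smul]
  exact ⟨rfl, rfl⟩

theorem list_apply_congr (B C : ι → Module.End F V) (X H : ι → Module.End F V) (n : ι → ℕ)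
    (hX : ∀ s t, s ≠ t → Commute (X s) (B t)) (hH : ∀ s t, s ≠ t → Commute (H s) (B t)) (v : V)
    (hXv : ∀ s, X s v = 0) (hHv : ∀ s, H s v = (n s : F) • v)
    (hCB : ∀ s w, X s w = 0 → H s w = (n s : F) • w → C s w = B s w) (l : List ι) (hl : l.Nodup) :
    (l.map C).prod v = (l.map B).prod v := by
  induction l with
  | nil => rfl
  | cons a l ih =>
    rw [List.nodup_cons] at hl
    obtain ⟨h1, h2⟩ := list_mem_U B X H n hX hH v hXv hHv l a hl.1
    simp only [List.map_cons, List.prod_cons, Module.End.mul_apply]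
    rw [ih hl.2, hCB a _ h1 h2]

theorem list_apply_ne (B : ι → Module.End F V) (X H : ι → Module.End F V) (n : ι → ℕ)
    (hX : ∀ s t, s ≠ t → Commute (X s) (B t)) (hH : ∀ s t, s ≠ t → Commute (H s) (B t)) (v : V)
    (hXv : ∀ s, X s v = 0) (hHv : ∀ s, H s v = (n s : F) • v) (hv : v ≠ 0)
    (hB : ∀ s w, X s w = 0 → H s w = (n s : F) • w → w ≠ 0 → B s w ≠ 0) (l : List ι) (hl : l.Nodup) :
    (l.map B).prod v ≠ 0 := by
  induction l with
  | nil => exact hv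
  | cons a l ih =>
    rw [List.nodup_cons] at hl
    obtain ⟨h1, h2⟩ := list_mem_U B X H n hX hH v hXv hHv l a hl.1
    simp only [List.map_cons, List.prod_cons, Module.End.mul_apply]
    exact hB a _ h1 h2 (ih hl.2)

theorem list_eigen (B : ι → Module.End F V) (H : Module.End F V) (c : ι → F) (μ : F) (v : V) (hv : H v = μ • v)
    (h : ∀ t w ν, H w = ν • w → H (B t w) = (ν + c t) • B t w) (l : List ι) :
    H ((l.map B).prod v) = (μ + (l.map c).sum) • (l.map B).prod v := by
  induction l with
  | nil => simpa using hv
  | cons a l ih =>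
    simp only [List.map_cons, List.prod_cons, Module.End.mul_apply, List.sum_cons]
    rw [h a _ _ ih]
    congr 1; ring

theorem nexp_smul_comm_of {Z B : A} (hZ : IsNilpotent Z) (h : Commute Z B) (t : F) : Commute (nexp F (t • Z)) B := by
  apply commute_nexp
  · obtain ⟨k, hk⟩ := hZ
    exact ⟨k, by rw [smul_pow, hk, smul_zero]⟩
  · exact h.smul_left t

/-- monomials of degree `n` -/
noncomputable def monoF (F : Type*) [Field F] (n : ℕ) (k : Fin (n + 1)) : homogeneousSubmodule (Fin 2) F n :=
  ⟨X 0 ^ (n - k : ℕ) * X 1 ^ (k : ℕ), by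
    rw [mem_homogeneousSubmodule]
    have := ((isHomogeneous_X F (0 : Fin 2)).pow (n - k : ℕ)).mul ((isHomogeneous_X F (1 : Fin 2)).pow (k : ℕ))
    have e : 1 * (n - k : ℕ) + 1 * (k : ℕ) = n := by omega
    rwa [e] at this⟩

theorem monoF_li (n : ℕ) : LinearIndependent F (monoF F n) := by
  apply LinearIndependent.of_comp (homogeneousSubmodule (Fin 2) F n).subtype
  have h := (basisMonomials (Fin 2) F).linearIndependent.comp
    (fun k : Fin (n + 1) => (Finsupp.single 0 (n - k : ℕ) + Finsupp.single 1 (k : ℕ) : Fin 2 →₀ ℕ)) (by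
      intro a b hab
      have := DFunLike.congr_fun hab 1
      simp at this
      exact Fin.ext this)
  convert h using 1
  ext1 k
  simp only [Function.comp, coe_basisMonomials, monoF, Submodule.subtype_apply]
  rw [X_pow_eq_monomial, X_pow_eq_monomial, monomial_mul, one_mul]

theorem monoF_span (n : ℕ) : ⊤ ≤ Submodule.span F (Set.range (monoF F n)) := by
  rintro p -
  have h : (p : MvPolynomial (Fin 2) F) ∈ (Submodule.span F (Set.range (monoF F n))).map
      (homogeneousSubmodule (Fin 2) F n).subtype := by
    refine hom_induction n (fun q => q ∈ (Submodule.span F (Set.range (monoF F n))).map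
      (homogeneousSubmodule (Fin 2) F n).subtype) (zero_mem _) (fun _ _ => add_mem)
      (fun c _ hp => Submodule.smul_mem _ c hp) ?_ _ p.2
    intro a k hak
    refine ⟨monoF F n ⟨k, by omega⟩, Submodule.subset_span ⟨_, rfl⟩, ?_⟩
    simp only [monoF, Submodule.subtype_apply]
    rw [show n - k = a by omega]
  obtain ⟨q, hq, hqp⟩ := h
  rwa [← Subtype.ext hqp]

/-- the monomial basis -/
noncomputable def monoBasis (F : Type*) [Field F] [CharZero F] (n : ℕ) :
    Module.Basis (Fin (n + 1)) F (homogeneousSubmodule (Fin 2) F n) :=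
  Module.Basis.mk (monoF_li n) (monoF_span n)

theorem monoBasis_apply (n : ℕ) (k : Fin (n + 1)) : monoBasis F n k = monoF F n k := by
  simp [monoBasis]
end P9a



set_option linter.unusedSectionVars false
section P10
variable {K F V : Type*} [Field K] [CharZero K] [Field F] [CharZero F] [IsAlgClosed F] [AddCommGroup V] [Module F V]
  [FiniteDimensional F V]

/-- the comparison map -/
noncomputable def PhiL {r : ℕ} (n : Fin r → ℕ) (Y : Fin r → Module.End F V) (v : V) :
    (⨂[F] s : Fin r, homogeneousSubmodule (Fin 2) F (n s)) →ₗ[F] V :=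
  PiTensorProduct.lift ((LinearMap.applyₗ v).compMultilinearMap
    ((MultilinearMap.mkPiAlgebraFin F r (Module.End F V)).compLinearMap
      (fun s => (psiL (n s) (Y s)).comp (homogeneousSubmodule (Fin 2) F (n s)).subtype)))

theorem PhiL_tprod {r : ℕ} (n : Fin r → ℕ) (Y : Fin r → Module.End F V) (v : V)
    (p : ∀ s : Fin r, homogeneousSubmodule (Fin 2) F (n s)) :
    PhiL n Y v (PiTensorProduct.tprod F p) = ((List.finRange r).map fun s => psiL (n s) (Y s) (p s)).prod v := by
  rw [PhiL, PiTensorProduct.lift.tprod, LinearMap.compMultilinearMap_apply, MultilinearMap.compLinearMap_apply,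
    MultilinearMap.mkPiAlgebraFin_apply, List.ofFn_eq_map]
  rfl

variable {ρ : GL (Fin 2) K →* Module.End F V} {r : ℕ} {φ : Fin r → K →+* F} {n : Fin r → ℕ}
    {f : Kˣ →* Fˣ} {X' Y H : Fin r → Module.End F V} {v : V}

theorem finRange_sum {A : Type*} [AddCommMonoid A] (Z : Fin r → A) : ∑ s, Z s = ((List.finRange r).map Z).sum := by
  rw [← List.ofFn_eq_map, List.sum_ofFn]

theorem uu_map (ψ : K →+* F) (x : K) : ((uu x : GL (Fin 2) K) : Matrix (Fin 2) (Fin 2) K).map ψ = !![1, ψ x; 0, 1] := by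
  ext i j; fin_cases i <;> fin_cases j <;> simp [uu]
theorem vv_map (ψ : K →+* F) (x : K) : ((vv x : GL (Fin 2) K) : Matrix (Fin 2) (Fin 2) K).map ψ = !![1, 0; ψ x, 1] := by
  ext i j; fin_cases i <;> fin_cases j <;> simp [vv]
theorem dd_map (ψ : K →+* F) (x : Kˣ) : ((dd x : GL (Fin 2) K) : Matrix (Fin 2) (Fin 2) K).map ψ = !![1, 0; 0, ψ x] := by
  ext i j; fin_cases i <;> fin_cases j <;> simp [dd]
theorem uu_det (x : K) : Matrix.GeneralLinearGroup.det (uu x) = 1 := by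
  apply Units.ext; simp [uu, Matrix.det_fin_two]
theorem vv_det (x : K) : Matrix.GeneralLinearGroup.det (vv x) = 1 := by
  apply Units.ext; simp [vv, Matrix.det_fin_two]
theorem dd_det (x : Kˣ) : Matrix.GeneralLinearGroup.det (dd x) = x := by
  apply Units.ext; simp [dd, Matrix.det_fin_two]

theorem isNilpotent_smul' {A : Type*} [Ring A] [Algebra F A] {Z : A} (h : IsNilpotent Z) (t : F) : IsNilpotent (t • Z) := by
  obtain ⟨k, hk⟩ := h
  exact ⟨k, by rw [smul_pow, hk, smul_zero]⟩

/-- intertwining property -/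
def GInter (ρ : GL (Fin 2) K →* Module.End F V) (φ : Fin r → K →+* F) (n : Fin r → ℕ) (f : Kˣ →* Fˣ)
    (Φ : (⨂[F] s : Fin r, homogeneousSubmodule (Fin 2) F (n s)) →ₗ[F] V) (g : GL (Fin 2) K) : Prop :=
  ∀ x, ρ g (Φ x) = ((f (Matrix.GeneralLinearGroup.det g) : Fˣ) : F) •
    Φ (PiTensorProduct.map (fun s => symPow (n s) ((g : Matrix (Fin 2) (Fin 2) K).map (φ s))) x)

theorem GInter.of_tprod {Φ : (⨂[F] s : Fin r, homogeneousSubmodule (Fin 2) F (n s)) →ₗ[F] V} {g : GL (Fin 2) K}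
    (h : ∀ p : (∀ s : Fin r, homogeneousSubmodule (Fin 2) F (n s)),
      ρ g (Φ (PiTensorProduct.tprod F p)) = ((f (Matrix.GeneralLinearGroup.det g) : Fˣ) : F) •
        Φ (PiTensorProduct.tprod F fun s => symPow (n s) ((g : Matrix (Fin 2) (Fin 2) K).map (φ s)) (p s))) :
    GInter ρ φ n f Φ g := by
  intro x
  induction x using PiTensorProduct.induction_on with
  | smul_tprod c p =>
    simp only [map_smul, PiTensorProduct.map_tprod]
    rw [h, smul_comm]
  | add x y hx hy => simp only [map_add, hx, hy, smul_add]

theorem GInter.mul {Φ : (⨂[F] s : Fin r, homogeneousSubmodule (Fin 2) F (n s)) →ₗ[F] V} {g h : GL (Fin 2) K}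
    (hg : GInter ρ φ n f Φ g) (hh : GInter ρ φ n f Φ h) : GInter ρ φ n f Φ (g * h) := by
  intro x
  have e : (fun s => symPow (n s) (((g * h : GL (Fin 2) K) : Matrix (Fin 2) (Fin 2) K).map (φ s))) =
      fun s => (symPow (n s) ((g : Matrix (Fin 2) (Fin 2) K).map (φ s))) ∘ₗ
        (symPow (n s) ((h : Matrix (Fin 2) (Fin 2) K).map (φ s))) := by
    funext s
    rw [← symPow_mul, Units.val_mul, Matrix.map_mul]
  rw [e, PiTensorProduct.map_comp, LinearMap.comp_apply, map_mul ρ, Module.End.mul_apply, hh, map_smul, hg, smul_smul,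
    map_mul, map_mul, Units.val_mul, mul_comm]

theorem inj_of_li {ι M : Type*} [AddCommMonoid M] [Module F M] (b : Module.Basis ι F M) (Φ : M →ₗ[F] V)
    (h : LinearIndependent F (Φ ∘ b)) : Function.Injective Φ := by
  intro x y hxy
  apply b.repr.injective
  apply h
  rw [← Finsupp.apply_linearCombination, ← Finsupp.apply_linearCombination, b.linearCombination_repr,
    b.linearCombination_repr, hxy]

namespace SplitData
variable (S : SplitData ρ φ n f X' Y H v)
include S

theorem inter_uu (x : K) : GInter ρ φ n f (PhiL n Y v) (uu x) := by
  apply GInter.of_tprod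
  intro p
  rw [PhiL_tprod, PhiL_tprod, uu_det, map_one, Units.val_one, one_smul, S.eX, finRange_sum,
    (nexp_list_sum (F := F) (fun s => φ s x • X' s) (fun s t => ((S.cX s t).smul_left _).smul_right _)
      (fun s => isNilpotent_smul' (S.nX s) _) _).2, ← Module.End.mul_apply, list_prod_mul _ _ _ _ (List.nodup_finRange r)]
  · apply list_apply_congr (X := X') (H := H) (n := n)
    · intro s t hst
      exact psiL_commute _ _ _ (S.XYc s t hst) _
    · intro s t hst
      exact psiL_commute _ _ _ (S.HYc s t hst) _
    · exact S.Xv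
    · exact S.Hv
    · intro s w h1 h2
      rw [Module.End.mul_apply, psiL_uu (n s) (S.XY s) (S.HY s) (S.nX s) h1 h2, uu_map]
    · exact List.nodup_finRange r
  · intro s t hst
    exact psiL_commute _ _ _ (nexp_smul_comm_of (S.nX s) (S.XYc s t hst) _) _

theorem inter_vv (x : K) : GInter ρ φ n f (PhiL n Y v) (vv x) := by
  apply GInter.of_tprod
  intro p
  rw [PhiL_tprod, PhiL_tprod, vv_det, map_one, Units.val_one, one_smul, S.eY, finRange_sum,
    (nexp_list_sum (F := F) (fun s => φ s x • Y s) (fun s t => ((S.cY s t).smul_left _).smul_right _)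
      (fun s => isNilpotent_smul' (S.nY s) _) _).2, ← Module.End.mul_apply, list_prod_mul _ _ _ _ (List.nodup_finRange r)]
  · apply list_apply_congr (X := X') (H := H) (n := n)
    · intro s t hst
      exact psiL_commute _ _ _ (S.XYc s t hst) _
    · intro s t hst
      exact psiL_commute _ _ _ (S.HYc s t hst) _
    · exact S.Xv
    · exact S.Hv
    · intro s w h1 h2
      rw [Module.End.mul_apply, psiL_vv (n s) (S.XY s) (S.HY s) (S.nY s) h1 h2, vv_map]
    · exact List.nodup_finRange r
  · intro s t hst
    exact psiL_commute _ _ _ (nexp_smul_comm_of (S.nY s) (S.cY s t) _) _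

theorem inter_dd (b : Kˣ) : GInter ρ φ n f (PhiL n Y v) (dd b) := by
  apply GInter.of_tprod
  intro p
  rw [PhiL_tprod, PhiL_tprod, dd_det, ← map_smul, ← S.dv]
  have key : ∀ l : List (Fin r), ρ (dd b) * (l.map fun s => psiL (n s) (Y s) (p s)).prod =
      (l.map fun s => psiL (n s) (Y s) (symPow (n s) (((dd b : GL (Fin 2) K) : Matrix (Fin 2) (Fin 2) K).map (φ s)) (p s))).prod *
        ρ (dd b) := by
    intro l
    induction l with
    | nil => simp
    | cons a l ih =>
      simp only [List.map_cons, List.prod_cons]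
      rw [mul_assoc _ _ (ρ (dd b)), ← ih, dd_map,
        ← psiL_dd (n a) (Y a) (ρ (dd b)) (ρ (dd b)⁻¹) _ (rho_inv_mul _ _) (rho_mul_inv _ _) (S.dY b a)]
      simp only [mul_assoc]
      rw [← mul_assoc (ρ (dd b)⁻¹), rho_inv_mul, one_mul]
  rw [← Module.End.mul_apply, key, Module.End.mul_apply]

theorem inter (g : GL (Fin 2) K) : GInter ρ φ n f (PhiL n Y v) g :=
  GL2_gen (fun g => GInter ρ φ n f (PhiL n Y v) g) (fun _ _ h1 h2 => h1.mul h2) S.inter_uu S.inter_vv S.inter_dd g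

theorem psi_mono (m : ℕ) (Z : Module.End F V) (k : Fin (m + 1)) :
    psiL m Z (monoF F m k) = (((m - k : ℕ).factorial / m.factorial : F)) • Z ^ (k : ℕ) := psiL_apply m Z _ _

theorem surj (hirr : Irr ρ) : Function.Surjective (PhiL n Y v) := by
  rw [← LinearMap.range_eq_top]
  refine (hirr _ ?_).resolve_left ?_
  · rintro g _ ⟨x, rfl⟩
    rw [S.inter g x]
    exact Submodule.smul_mem _ _ ⟨_, rfl⟩
  · intro h
    apply S.v0
    rw [← Submodule.mem_bot F, ← h]
    refine ⟨PiTensorProduct.tprod F fun s => monoF F (n s) 0, ?_⟩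
    rw [PhiL_tprod]
    have : ∀ s, psiL (n s) (Y s) (monoF F (n s) 0) = 1 := by
      intro s
      rw [S.psi_mono]
      have : ((n s).factorial : F) ≠ 0 := by exact_mod_cast (n s).factorial_ne_zero
      simp [this]
    simp [this]

theorem li : LinearIndependent F (PhiL n Y v ∘ Basis.piTensorProduct (fun s => monoBasis F (n s))) := by
  have h1 := (Module.End.independent_iInf_maxGenEigenspace_of_forall_mapsTo H (fun i j c =>
    Module.End.mapsTo_maxGenEigenspace_of_comm (S.cH j i) c))
  have hinj : Function.Injective (fun (α : ∀ s, Fin (n s + 1)) (s : Fin r) => (n s : F) - 2 * ((α s : ℕ) : F)) := by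
    intro α β h
    funext s
    have := congrFun h s
    simp only [sub_right_inj, mul_eq_mul_left_iff, OfNat.ofNat_ne_zero, or_false, Nat.cast_inj] at this
    exact Fin.ext this
  have hv : ∀ α, (PhiL n Y v ∘ Basis.piTensorProduct (fun s => monoBasis F (n s))) α =
      ((List.finRange r).map fun s => (((n s - α s : ℕ).factorial / (n s).factorial : F)) • Y s ^ (α s : ℕ)).prod v := by
    intro α
    rw [Function.comp_apply, Basis.piTensorProduct_apply]
    simp only [monoBasis_apply]
    rw [PhiL_tprod]
    simp only [S.psi_mono]
  apply (h1.comp hinj).linearIndependent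
  · intro α
    rw [hv, Function.comp_apply, Submodule.mem_iInf]
    intro s
    rw [Module.End.mem_maxGenEigenspace]
    refine ⟨1, ?_⟩
    rw [pow_one, LinearMap.sub_apply, LinearMap.smul_apply, Module.End.one_apply, sub_eq_zero,
      list_eigen _ (H s) (fun t => if t = s then - (2 * ((α s : ℕ) : F)) else 0) (n s) v (S.Hv s)]
    · rw [← finRange_sum]
      simp [sub_eq_add_neg]
    · intro t w ν hw
      by_cases hts : t = s
      · subst hts
        rw [LinearMap.smul_apply, map_smul, H_pow_Y (S.HY t) hw, smul_comm, if_pos rfl, sub_eq_add_neg]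
      · have hc := ((S.HYc s t (Ne.symm hts)).pow_right (α t : ℕ)).eq
        rw [LinearMap.smul_apply, map_smul, ← Module.End.mul_apply, hc, Module.End.mul_apply, hw, map_smul, smul_comm,
          if_neg hts, add_zero]
  · intro α
    rw [hv]
    apply list_apply_ne (X := X') (H := H) (n := n)
    · intro s t hst
      exact ((S.XYc s t hst).pow_right _).smul_right _
    · intro s t hst
      exact ((S.HYc s t hst).pow_right _).smul_right _
    · exact S.Xv
    · exact S.Hv
    · exact S.v0
    · intro s w h1 h2 hw h
      have h3 : (((n s - α s : ℕ).factorial / (n s).factorial : F)) ≠ 0 :=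
        div_ne_zero (by exact_mod_cast Nat.factorial_ne_zero _) (by exact_mod_cast Nat.factorial_ne_zero _)
      have h4 := (smul_eq_zero.1 h).resolve_left h3
      have h5 := X_pow_Y_pow (S.XY s) (S.HY s) h1 h2 (n s - α s) (α s) (by omega) (α s)
      rw [h4, map_zero, Nat.sub_self, pow_zero, Module.End.one_apply, Nat.descFactorial_self] at h5
      refine hw ((smul_eq_zero.1 h5.symm).resolve_left (mul_ne_zero ?_ ?_))
      · exact_mod_cast Nat.factorial_ne_zero _
      · exact_mod_cast (Nat.ascFactorial_pos _ _).ne'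
    · exact List.nodup_finRange r

theorem inj : Function.Injective (PhiL n Y v) := by
  have h := S.li
  generalize Basis.piTensorProduct (fun s => monoBasis F (n s)) = b at h
  generalize PhiL n Y v = Φ at h ⊢
  exact inj_of_li b Φ h

theorem one_le (hirr : Irr ρ) (s : Fin r) : 1 ≤ n s := by
  by_contra hlt
  have h0 : n s = 0 := by omega
  have hYv : Y s v = 0 := by
    have := Y_pow_zero (S.XY s) (S.HY s) (S.Xv s) (S.Hv s) (S.nY s) 1 (by omega)
    simpa using this
  have hY : Y s = 0 := by
    apply LinearMap.ext
    intro w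
    obtain ⟨x, rfl⟩ := S.surj hirr w
    induction x using PiTensorProduct.induction_on with
    | smul_tprod c p =>
      rw [map_smul, map_smul, PhiL_tprod, list_comm _ _ _ (fun t _ => psiL_commute _ _ _ (S.cY s t) _), hYv, map_zero,
        smul_zero]
      rfl
    | add x y hx hy => rw [map_add, map_add, hx, hy]; simp
  have hH : H s = 0 := by rw [← S.XY, hY, br_zero]
  have := S.HX s
  rw [hH, zero_br] at this
  exact S.X0 s ((smul_eq_zero.1 this.symm).resolve_left two_ne_zero)
end SplitData

theorem main_end [Nontrivial V] (ρ : GL (Fin 2) K →* Module.End F V) (hirr : Irr ρ) :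
    ∃ (r : ℕ) (n : Fin r → ℕ) (_ : ∀ s, 1 ≤ n s) (φ : Fin r → K →+* F) (f : Kˣ →* Fˣ),
      (∏ s, (n s + 1)) = Module.finrank F V ∧
      ∃ e : V ≃ₗ[F] (⨂[F] s : Fin r, homogeneousSubmodule (Fin 2) F (n s)),
        ∀ (g : GL (Fin 2) K) (v : V), e (ρ g v) = ((f (Matrix.GeneralLinearGroup.det g) : Fˣ) : F) •
          PiTensorProduct.map (fun s => symPow (n s) ((g : Matrix (Fin 2) (Fin 2) K).map (φ s))) (e v) := by
  obtain ⟨r, φ, n, f, X', Y, H, v, S⟩ := exists_split ρ hirr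
  let e := LinearEquiv.ofBijective (PhiL n Y v) ⟨S.inj, S.surj hirr⟩
  refine ⟨r, n, S.one_le hirr, φ, f, ?_, e.symm, ?_⟩
  · rw [← e.finrank_eq, Module.finrank_eq_card_basis (Basis.piTensorProduct (fun s => monoBasis F (n s))), Fintype.card_pi]
    simp
  · intro g w
    rw [LinearEquiv.symm_apply_eq, map_smul]
    have := S.inter g (e.symm w)
    rw [show PhiL n Y v (e.symm w) = w from e.apply_symm_apply w] at this
    exact this
end P10

/-- **Wong, Proposition 7 (after Borel–Tits).**  Let `K` be a field of characteristic zero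
with algebraic closure `K̄`.  Every abstract (not assumed continuous) absolutely irreducible
group homomorphism `ρ : GL_2(K) → GL_d(K̄)` is equivalent to a representation of the form
`[⊗_{s=1}^r (σ_{φ_s}^{(n_s)} ∘ φ_s)] ⊗ (f ∘ det)` for some `r ≥ 0`, positive integers
`n_1, …, n_r` with `∏ (n_s + 1) = d`, field homomorphisms `φ_s : K → K̄`, and a
homomorphism of multiplicative groups `f : Kˣ → K̄ˣ`.  The equivalence is expressed by a
`K̄`-linear isomorphism `e` from `K̄^d` to the tensor product of the symmetric powers which
intertwines `ρ` with the twisted symmetric-power action scaled by `f(det g)`. -/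
theorem abstract_irreducible_rep_of_GL2 (K : Type*) [Field K] [CharZero K]
    (d : ℕ) (hd : 0 < d)
    (ρ : GL (Fin 2) K →* GL (Fin d) (AlgebraicClosure K))
    (hirr : ∀ W : Submodule (AlgebraicClosure K) (Fin d → AlgebraicClosure K),
      (∀ (g : GL (Fin 2) K), ∀ w ∈ W,
        ((ρ g : Matrix (Fin d) (Fin d) (AlgebraicClosure K))).mulVec w ∈ W) →
      W = ⊥ ∨ W = ⊤) :
    ∃ (r : ℕ) (nn : Fin r → ℕ) (_ : ∀ s, 1 ≤ nn s)
      (φ : Fin r → (K →+* AlgebraicClosure K))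
      (f : Kˣ →* (AlgebraicClosure K)ˣ),
      (∏ s, (nn s + 1)) = d ∧
      ∃ e : (Fin d → AlgebraicClosure K) ≃ₗ[AlgebraicClosure K]
          (⨂[AlgebraicClosure K] s : Fin r,
            homogeneousSubmodule (Fin 2) (AlgebraicClosure K) (nn s)),
        ∀ (g : GL (Fin 2) K) (v : Fin d → AlgebraicClosure K),
          e (((ρ g : Matrix (Fin d) (Fin d) (AlgebraicClosure K))).mulVec v) =
            ((f (Matrix.GeneralLinearGroup.det g) : (AlgebraicClosure K)ˣ) : AlgebraicClosure K) •
              PiTensorProduct.map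
                (fun s => symPow (nn s)
                  (((g : Matrix (Fin 2) (Fin 2) K)).map (φ s))) (e v) := by
  have : Nonempty (Fin d) := ⟨⟨0, hd⟩⟩
  let ρ' : GL (Fin 2) K →* Module.End (AlgebraicClosure K) (Fin d → AlgebraicClosure K) :=
    ((Matrix.toLinAlgEquiv' : Matrix (Fin d) (Fin d) (AlgebraicClosure K) ≃ₐ[AlgebraicClosure K] _) :
      Matrix (Fin d) (Fin d) (AlgebraicClosure K) →* _).comp ((Units.coeHom _).comp ρ)
  have hρ' : ∀ g v, ρ' g v = ((ρ g : Matrix (Fin d) (Fin d) (AlgebraicClosure K))).mulVec v := fun g v => rfl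
  have hirr' : Irr ρ' := fun W hW => hirr W hW
  obtain ⟨r, n, hn, φ, f, h1, e, h2⟩ := main_end ρ' hirr'
  refine ⟨r, n, hn, φ, f, by rw [h1, Module.finrank_fin_fun], e, ?_⟩
  intro g v
  rw [← hρ', h2]
end

section
/- For every integer n > 1 there exists a constant c_1(n) > 0 such that for every prime l, every finite-dimensional complex irreducible representation of Sp_{2n}(ℤ/lℤ) whose image is a non-abelian group has degree strictly greater than c_1(n) · l. -/
namespace SpAux
open Matrix
variable {l : Type*} [DecidableEq l] [Fintype l]


lemma exists_symmetric_X_invertible_add_mul_of_ker_inter_eq_bot {R : Type*} [Field R]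
    {A C : Matrix l l R} (hker : ∀ (x : l → R), (A • x = 0) → (C • x = 0) → x = 0)
    (hsymm : Aᵀ * C = Cᵀ * A) :
    ∃ (X : Matrix l l R), X.IsSymm ∧ IsUnit (A + X * C) := by
  -- `C` is transformed into `P = fromBlocks 1 0 0 0` by invertible matrices `V` and `U`.
  rcases exists_rank_normal_form C with ⟨V, U, s, hV, hU, heq⟩
  set P := V * C * U with P_def; set Q := Vᵀ⁻¹ * A * U with Q_def
  set f := fun (x : Matrix l l R) ↦ x.submatrix s.symm s.symm
  have hf (x) : f x = x.submatrix s.symm s.symm := rfl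
  have f_unit {x} : IsUnit x → IsUnit (f x) := (isUnit_submatrix_equiv ..).2
  have f_mul (x y) : f (x * y) = f x * f y := submatrix_mul _ _ _ _ _ s.symm.bijective
  have _ : Invertible V := hV.invertible
  have _ : Invertible U := hU.invertible
  have _ : Invertible (f Vᵀ) := (f_unit (V.isUnit_transpose.2 hV)).invertible
  -- The hypothesis that the only vector annihilated by both matrices is 0, holds for `P` and `Q`.
  have con1 (x : Fin C.rank ⊕ Fin (Fintype.card l - C.rank) → R)
      (heq1 : (f Q) • x = 0) (heq2 : (f P) • x = 0) : x = 0 := by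
    refine (f_unit hU).smul_left_cancel.1 ?_
    rw [f_mul, f_mul, mul_assoc, mul_smul, IsUnit.smul_eq_zero, mul_smul, hf,
      smul_eq_mulVec, submatrix_mulVec_equiv, Equiv.symm_symm] at heq1 heq2
    · rw [Equiv.comp_symm_eq, Pi.zero_comp] at heq1 heq2
      exact s.surjective.injective_comp_right <| by simpa using hker _ heq1 heq2
    · exact f_unit hV
    · exact f_unit <| isUnit_nonsing_inv_iff.2 <| V.isUnit_transpose.2 hV
  -- The symmetry relation also holds for `P` and `Q`.
  have con2 : Qᵀ * P = Pᵀ * Q := by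
    simp only [P_def, mul_assoc, transpose_mul, transpose_nonsing_inv, transpose_transpose, Q_def,
      inv_mul_cancel_left_of_invertible, mul_inv_cancel_left_of_invertible]
    rw [← mul_assoc Aᵀ, hsymm, mul_assoc]
  replace con2 : (f Q).toBlocks₁₁ᵀ = (f Q).toBlocks₁₁ ∧ (f Q).toBlocks₁₂ = 0 := by
    apply_fun reindex s s at con2
    rw [reindex_apply, reindex_apply, ← hf, ← hf, f_mul, f_mul Pᵀ, heq, hf,
      ← transpose_submatrix, ← hf Q, ← (f Q).fromBlocks_toBlocks, hf (_)ᵀ, hf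
      ((fromBlocks 1 0 0 0).submatrix _ _)] at con2
    simp [fromBlocks_transpose, fromBlocks_multiply] at con2; tauto
  -- The lower-right block of `Q` is invertible.
  have con3 : IsUnit (f Q).toBlocks₂₂ := by
    refine mulVec_injective_iff_isUnit.1 ?_
    rw [← coe_mulVecLin, ← LinearMap.ker_eq_bot]
    refine ker_mulVecLin_eq_bot_iff.2 fun x hx ↦ Sum.elim_injective' <|
      (con1 _ ?_ ?_).trans Sum.elim_zero_zero.symm
    · rw [← (f Q).fromBlocks_toBlocks]; simp [hx, con2.2, fromBlocks_mulVec]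
    · simp [hf, heq, fromBlocks_mulVec]
  set Y : Matrix (Fin C.rank ⊕ Fin (Fintype.card l - C.rank)) (Fin C.rank ⊕
    Fin (Fintype.card l - C.rank)) R := fromBlocks (1 - (f Q).toBlocks₁₁) 0 0 0 with Y_def
  have hY_symm : Y.IsSymm := by
    rw [Y_def, isSymm_fromBlocks_iff]
    exact ⟨IsSymm.sub isSymm_one con2.1, by simp⟩
  -- We now take `X = Vᵀ * Y * V` and this gives the desired matrix `X.submatrix s s`.
  set X := (f Vᵀ) * Y * (f V) with X_def
  refine ⟨X.submatrix s s, IsSymm.submatrix ?_ s, (isUnit_submatrix_equiv s.symm s.symm).1 ?_⟩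
  · simp_rw [X_def, Matrix.IsSymm, transpose_mul, hY_symm.eq, hf, transpose_submatrix,
      transpose_transpose, mul_assoc]
  · have heq' : f (A + X.submatrix s s * C) = (f Vᵀ) * (f Q + Y * (f P)) * f (U⁻¹) := by
      simp_rw [hf, submatrix_add, Pi.add_apply, Q_def, P_def, ← hf, f_mul, hf, mul_add, ← mul_assoc,
        ← inv_submatrix_equiv, add_mul, mul_assoc _ (U.submatrix _ _), mul_inv_of_invertible]
      simp [X_def]; rfl
    rw [← hf, heq', IsUnit.mul_iff, IsUnit.mul_iff]
    refine ⟨⟨isUnit_of_invertible _, ?_⟩, ?_⟩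
    · nth_rw 1 [Y_def, heq, ← (f Q).fromBlocks_toBlocks, con2.2]
      simpa [hf, fromBlocks_multiply, fromBlocks_add]
    · exact f_unit <| isUnit_nonsing_inv_iff.2 hU

lemma eig_card {V : Type*} [AddCommGroup V] [Module ℂ V] [FiniteDimensional ℂ V]
    (l : ℕ) (hl : l.Prime) (f : Module.End ℂ V) (hf : f ≠ 1) (hfl : f ^ l = 1)
    (hconj : ∀ a : ℕ, 0 < a → a < l → ∃ p q : Module.End ℂ V, q * p = 1 ∧ f * p = p * f ^ (a ^ 2)) :
    (l - 1) / 2 ≤ Module.finrank ℂ V := by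
  have hss : f.IsSemisimple := by
    apply Module.End.isSemisimple_of_squarefree_aeval_eq_zero (p := Polynomial.X ^ l - 1)
    · apply Polynomial.Separable.squarefree
      have := (Polynomial.separable_X_pow_sub_C (F := ℂ) (n := l) 1
        (by exact_mod_cast hl.ne_zero) one_ne_zero)
      simpa using this
    · simp [hfl]
  have hpow : ∀ (μ : ℂ) (k : ℕ) (v : V), f v = μ • v → (f ^ k) v = μ ^ k • v := by
    intro μ k v h
    induction k with
    | zero => simp
    | succ k ih => rw [pow_succ, Module.End.mul_apply, h, map_smul, ih, smul_smul, pow_succ']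
  obtain ⟨ζ, hζ1, v, hv0, hv⟩ : ∃ ζ : ℂ, ζ ≠ 1 ∧ ∃ v, v ≠ 0 ∧ f v = ζ • v := by
    by_contra! hcon
    apply hf
    have htop := Module.End.iSup_maxGenEigenspace_eq_top f
    have hle : (⨆ μ, f.maxGenEigenspace μ) ≤ f.eigenspace 1 := by
      refine iSup_le fun μ => ?_
      rw [hss.isFinitelySemisimple.maxGenEigenspace_eq_eigenspace]
      intro v hv
      by_cases h : μ = 1
      · rwa [← h]
      · by_cases h0 : v = 0
        · rw [h0]; exact zero_mem _
        · exact absurd (Module.End.mem_eigenspace_iff.1 hv) (hcon μ h v h0)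
    rw [htop] at hle
    ext v
    simpa using Module.End.mem_eigenspace_iff.1 (hle (Submodule.mem_top (x := v)))
  have hζl : ζ ^ l = 1 := by
    have := hpow ζ l v hv
    rw [hfl, Module.End.one_apply] at this
    have h2 : (ζ ^ l - 1) • v = 0 := by rw [sub_smul, ← this, one_smul, sub_self]
    rcases smul_eq_zero.1 h2 with h | h
    · exact sub_eq_zero.1 h
    · exact absurd h hv0
  have hord : orderOf ζ = l := by
    have : Fact l.Prime := ⟨hl⟩
    exact orderOf_eq_prime hζl hζ1
  have hex : ∀ i : Fin ((l - 1) / 2), ∃ w : V, f.HasEigenvector (ζ ^ ((i.1 + 1) ^ 2)) w := by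
    intro i
    obtain ⟨p, q, hqp, hp⟩ := hconj (i.1 + 1) (by omega) (by have := i.2; omega)
    refine ⟨p v, ?_, ?_⟩
    · rw [Module.End.mem_genEigenspace_one, ← Module.End.mul_apply, hp, Module.End.mul_apply,
        hpow _ _ _ hv, map_smul]
    · intro h
      apply hv0
      have : q (p v) = v := by rw [← Module.End.mul_apply, hqp, Module.End.one_apply]
      rw [← this, h, map_zero]
  choose w hw using hex
  have hinj : Function.Injective (fun i : Fin ((l - 1) / 2) => ζ ^ ((i.1 + 1) ^ 2)) := by
    intro i j hij
    have h1 : (i.1 + 1) ^ 2 ≡ (j.1 + 1) ^ 2 [MOD l] := by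
      have hp : IsPrimitiveRoot ζ l := IsPrimitiveRoot.iff_orderOf.2 hord
      have hm : ∀ x : ℕ, ζ ^ (x % l) = ζ ^ x := by
        intro x
        have := pow_mod_orderOf ζ x
        rwa [hord] at this
      refine hp.pow_inj (Nat.mod_lt _ hl.pos) (Nat.mod_lt _ hl.pos) ?_
      rw [hm, hm]
      exact hij
    have h2 := (Nat.modEq_iff_dvd.1 h1)
    push_cast at h2
    have h3 : (l : ℤ) ∣ ((j.1 : ℤ) - i.1) * (i.1 + j.1 + 2) := by
      convert h2 using 1; ring
    have hi := i.2
    have hj := j.2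
    rcases (Nat.prime_iff_prime_int.1 hl).dvd_or_dvd h3 with h | h
    · have := Int.eq_zero_of_abs_lt_dvd h (by rw [abs_lt]; omega)
      ext; omega
    · have := Int.le_of_dvd (by omega) h
      omega
  have := (Module.End.eigenvectors_linearIndependent' f _ hinj w hw).fintype_card_le_finrank
  simpa using this

variable {K : Type*} [Field K]

/-- Upper unipotent element. -/
def up (X : Matrix l l K) (h : X.IsSymm) : symplecticGroup l K :=
  ⟨fromBlocks 1 X 0 1, by rw [SymplecticGroup.fromBlocks_mem_iff]; simp [h.eq]⟩

/-- Lower unipotent element. -/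
def lo (X : Matrix l l K) (h : X.IsSymm) : symplecticGroup l K :=
  ⟨fromBlocks 1 0 X 1, by rw [SymplecticGroup.fromBlocks_mem_iff]; simp [h.eq]⟩

/-- Levi element. -/
def lev (A B : Matrix l l K) (h : Aᵀ * B = 1) : symplecticGroup l K :=
  ⟨fromBlocks A 0 0 B, by rw [SymplecticGroup.fromBlocks_mem_iff]; simp [h]⟩

lemma gen (N : Subgroup (symplecticGroup l K)) [N.Normal]
    (hup : ∀ X h, up (l := l) (K := K) X h ∈ N) : N = ⊤ := by
  have hlo : ∀ X h, lo (l := l) (K := K) X h ∈ N := by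
    intro X h
    have h' : (-X).IsSymm := h.neg
    have := Subgroup.Normal.conj_mem ‹_› _ (hup (-X) h') (SymplecticGroup.symJ l K)
    convert this using 1
    rw [eq_mul_inv_iff_mul_eq]
    apply Subtype.ext
    simp [lo, up, J, fromBlocks_multiply]
  -- Levi elements attached to products of symmetric matrices
  have hw : ∀ (X Y : Matrix l l K) (hX : X.IsSymm) (hY : Y.IsSymm) (h : X * Y = 1),
      ∃ g ∈ N, (g : Matrix (l ⊕ l) (l ⊕ l) K) = fromBlocks 0 X (-Y) 0 := by
    intro X Y hX hY h
    refine ⟨up X hX * lo (-Y) hY.neg * up X hX,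
      N.mul_mem (N.mul_mem (hup _ _) (hlo _ _)) (hup _ _), ?_⟩
    have h2 : Y * X = 1 := mul_eq_one_comm.1 h
    simp [lo, up, fromBlocks_multiply, h, h2]
  have hsym : ∀ (X Y : Matrix l l K) (hX : X.IsSymm) (h : Xᵀ * Y = 1), lev X Y h ∈ N := by
    intro X Y hX h
    have h' : X * Y = 1 := by rwa [hX.eq] at h
    have hY : Y.IsSymm := by
      have h1 := congrArg transpose h'
      rw [transpose_mul, hX.eq, transpose_one] at h1
      have h2 : Y * X = 1 := mul_eq_one_comm.1 h'
      calc Yᵀ = Yᵀ * (X * Y) := by rw [h', mul_one]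
        _ = Y := by rw [← mul_assoc, h1, one_mul]
    obtain ⟨g, hg, hgm⟩ := hw X Y hX hY h'
    obtain ⟨k, hk, hkm⟩ := hw (-1) (-1) isSymm_one.neg isSymm_one.neg (by simp)
    convert N.mul_mem hg hk using 1
    apply Subtype.ext
    simp [lev, hgm, hkm, fromBlocks_multiply]
  have hmul : ∀ A A' : Matrix l l K, A.det ≠ 0 → A'.det ≠ 0 →
      (∀ B (h : Aᵀ * B = 1), lev A B h ∈ N) → (∀ B (h : A'ᵀ * B = 1), lev A' B h ∈ N) →
      ∀ B (h : (A * A')ᵀ * B = 1), lev (A * A') B h ∈ N := by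
    intro A A' hA hA' h1 h2 B h
    have e1 : Aᵀ * (Aᵀ)⁻¹ = 1 := mul_nonsing_inv _ (by simpa using hA)
    have e2 : A'ᵀ * (A'ᵀ)⁻¹ = 1 := mul_nonsing_inv _ (by simpa using hA')
    have hB : B = (Aᵀ)⁻¹ * (A'ᵀ)⁻¹ := by
      have : (A * A')ᵀ * ((Aᵀ)⁻¹ * (A'ᵀ)⁻¹) = 1 := by
        rw [transpose_mul, mul_assoc, ← mul_assoc Aᵀ, e1, one_mul, e2]
      rw [← Matrix.inv_eq_right_inv h, Matrix.inv_eq_right_inv this]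
    convert N.mul_mem (h1 _ e1) (h2 _ e2) using 1
    apply Subtype.ext
    simp [lev, fromBlocks_multiply, hB]
  have hlev : ∀ (A : Matrix l l K), A.det ≠ 0 → ∀ B (h : Aᵀ * B = 1), lev A B h ∈ N := by
    intro A hA
    refine diagonal_transvection_induction_of_det_ne_zero
      (fun A => ∀ B (h : Aᵀ * B = 1), lev A B h ∈ N) A hA ?_ ?_ ?_
    · intro D hD B h
      exact hsym _ _ (isSymm_diagonal D) h
    · rintro ⟨i, j, hij, c⟩
      have hdet : (transvection i j c).det ≠ 0 := by simp [hij]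
      have hPP : swap K i j * swap K i j = 1 := swap_mul_self i j
      have hPs : (swap K i j).IsSymm := isSymm_swap i j
      have hPd : (swap K i j).det ≠ 0 := by
        intro h0
        have := congrArg det hPP
        simp [h0] at this
      have hS : (transvection i j c * swap K i j).IsSymm := by
        have : transvection i j c * swap K i j = swap K i j + single i i c := by
          rw [transvection, add_mul, one_mul]
          congr 1
          refine Matrix.ext fun a b => ?_
          by_cases hb : b = i
          · subst hb; simp [single_apply]
          · by_cases hb' : b = j
            · subst hb'; simp [single_apply, hij, hij.symm]
            · rw [mul_swap_of_ne hb hb']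
              simp [single_apply, Ne.symm hb, Ne.symm hb']
        rw [this]
        exact hPs.add (by simp [Matrix.IsSymm])
      have hA : transvection i j c = (transvection i j c * swap K i j) * swap K i j := by
        rw [mul_assoc, hPP, mul_one]
      have := hmul (transvection i j c * swap K i j) (swap K i j)
        (by rw [det_mul]; exact mul_ne_zero hdet hPd) hPd
        (fun B h => hsym _ _ hS h) (fun B h => hsym _ _ hPs h)
      rw [← hA] at this
      exact this
    · exact hmul
  rw [eq_top_iff]
  rintro ⟨M, hM⟩ -
  set A := M.toBlocks₁₁; set B := M.toBlocks₁₂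
  set C := M.toBlocks₂₁; set D := M.toBlocks₂₂
  have hMb : M = fromBlocks A B C D := (M.fromBlocks_toBlocks).symm
  have hker (x : l → K) (hx1 : A *ᵥ x = 0) (hx2 : C *ᵥ x = 0) : x = 0 := by
    have hu : IsUnit M := M.isUnit_iff_isUnit_det.2 (SymplecticGroup.symplectic_det hM)
    have hv0 : M *ᵥ (Sum.elim x 0) = M *ᵥ (Sum.elim 0 0) := by
      rw [hMb]; simp [fromBlocks_mulVec, hx1, hx2]
    exact (Sum.elim_eq_iff.1 (mulVec_injective_iff_isUnit.2 hu hv0)).1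
  obtain ⟨X, hX, hXu⟩ := exists_symmetric_X_invertible_add_mul_of_ker_inter_eq_bot hker
    (SymplecticGroup.fromBlocks_mem_iff.1 (hMb ▸ hM)).1
  have key : ∀ g : symplecticGroup l K, IsUnit (g : Matrix (l ⊕ l) (l ⊕ l) K).toBlocks₁₁ →
      g ∈ N := by
    rintro ⟨M, hM⟩ hu
    obtain ⟨A, B, C, D, rfl⟩ : ∃ A B C D, M = fromBlocks A B C D :=
      ⟨_, _, _, _, (M.fromBlocks_toBlocks).symm⟩
    simp only [toBlocks_fromBlocks₁₁] at hu
    have hAd : IsUnit A.det := A.isUnit_iff_isUnit_det.1 hu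
    obtain ⟨r1, -, r3⟩ := SymplecticGroup.fromBlocks_mem_iff.1 hM
    have e1 : A * A⁻¹ = 1 := mul_nonsing_inv _ hAd
    have e2 : A⁻¹ * A = 1 := nonsing_inv_mul _ hAd
    have e3 : Aᵀ * A⁻¹ᵀ = 1 := by rw [← transpose_mul, e2, transpose_one]
    have e4 : A⁻¹ᵀ * Aᵀ = 1 := by rw [← transpose_mul, e1, transpose_one]
    have hs : (C * A⁻¹).IsSymm := by
      rw [Matrix.IsSymm, transpose_mul]
      calc A⁻¹ᵀ * Cᵀ = A⁻¹ᵀ * (Cᵀ * A) * A⁻¹ := by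
            rw [mul_assoc, mul_assoc, e1, mul_one]
        _ = C * A⁻¹ := by rw [← r1, ← mul_assoc, e4, one_mul]
    -- clear the lower left block
    set g : symplecticGroup l K := ⟨fromBlocks A B C D, hM⟩ with hg
    set g2 := lev A⁻¹ Aᵀ (by rw [← transpose_mul, e1, transpose_one]) * (lo (-(C * A⁻¹)) hs.neg * g)
      with hg2
    have hg2m : (g2 : Matrix (l ⊕ l) (l ⊕ l) K) =
        fromBlocks 1 (A⁻¹ * B) 0 (Aᵀ * (D - C * A⁻¹ * B)) := by
      simp [hg2, hg, lev, lo, fromBlocks_multiply, e2, mul_assoc, sub_eq_neg_add]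
    obtain ⟨-, s2, s3⟩ := SymplecticGroup.fromBlocks_mem_iff.1 (hg2m ▸ g2.2)
    simp only [transpose_one, one_mul, transpose_zero, zero_mul, sub_zero] at s3
    rw [s3] at s2 hg2m
    simp only [mul_one, transpose_one, one_mul] at s2
    have : g2 = up (A⁻¹ * B) s2 := Subtype.ext hg2m
    have hm : g2 ∈ N := this ▸ hup _ _
    rw [hg2] at hm
    rw [N.mul_mem_cancel_left (hlev _ (by simpa using hAd.ne_zero) _ _),
      N.mul_mem_cancel_left (hlo _ _)] at hm
    exact hm
  have := key (up X hX * ⟨M, hM⟩) (by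
    rw [Submonoid.coe_mul]
    simpa [hMb, up, fromBlocks_multiply] using hXu)
  exact (N.mul_mem_cancel_left (hup X hX)).1 this

lemma up_mul (X Y : Matrix l l K) (hX : X.IsSymm) (hY : Y.IsSymm) :
    up X hX * up Y hY = up (X + Y) (hX.add hY) := by
  apply Subtype.ext
  simp [up, fromBlocks_multiply, add_comm]

lemma up_pow (X : Matrix l l K) (hX : X.IsSymm) (k : ℕ) (h : ((k : K) • X).IsSymm) :
    up X hX ^ k = up ((k : K) • X) h := by
  induction k with
  | zero => apply Subtype.ext; simp [up, fromBlocks_one]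
  | succ k ih =>
    rw [pow_succ, ih (hX.smul _), up_mul]
    apply Subtype.ext
    simp [up, add_smul]

lemma up_conj (X : Matrix l l K) (hX : X.IsSymm) (a : ℕ) (ha : (a : K) ≠ 0) :
    ∃ g : symplecticGroup l K, up X hX * g⁻¹ = g⁻¹ * up X hX ^ (a ^ 2) := by
  refine ⟨lev ((a : K) • 1) ((a : K)⁻¹ • 1) (by simp [smul_smul, ha]), ?_⟩
  rw [up_pow X hX _ (hX.smul _), mul_inv_eq_iff_eq_mul, mul_assoc, eq_inv_mul_iff_mul_eq]
  apply Subtype.ext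
  have : (a : K)⁻¹ * (a : K) ^ 2 = a := by field_simp
  simp [up, lev, fromBlocks_multiply, smul_smul, this]

end SpAux

/-- **Wong, Lemma 10 for `Sp_{2n}`.**  For every integer `n > 1` there is a constant
`c₁(n) > 0` such that for every prime `l`, every finite-dimensional complex irreducible
representation of `Sp_{2n}(ℤ/lℤ)` with non-abelian image has degree `> c₁(n) · l`. -/
theorem min_degree_nonabelian_irrep_Sp (n : ℕ) (hn : 1 < n) :
    ∃ c : ℝ, 0 < c ∧
      ∀ (l : ℕ), Nat.Prime l →
      ∀ (V : Type) [AddCommGroup V] [Module ℂ V] [FiniteDimensional ℂ V]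
        (ρ : Representation ℂ (Matrix.symplecticGroup (Fin n) (ZMod l)) V),
        -- `ρ` is irreducible:
        (∀ W : Submodule ℂ V,
          (∀ (g : Matrix.symplecticGroup (Fin n) (ZMod l)), ∀ w ∈ W, ρ g w ∈ W) →
          W = ⊥ ∨ W = ⊤) →
        -- the image of `ρ` is non-abelian:
        (∃ g h : Matrix.symplecticGroup (Fin n) (ZMod l), ρ g * ρ h ≠ ρ h * ρ g) →
        c * l < (Module.finrank ℂ V : ℝ) := by
  refine ⟨1 / 5, by norm_num, ?_⟩
  intro l hl V _ _ _ ρ _ ⟨g, h, hgh⟩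
  have : Fact l.Prime := ⟨hl⟩
  have hpos : 0 < Module.finrank ℂ V := by
    rcases subsingleton_or_nontrivial V with hV | hV
    · exact absurd (LinearMap.ext fun v => Subsingleton.elim _ _) hgh
    · exact Module.finrank_pos
  have hdim : (l - 1) / 2 ≤ Module.finrank ℂ V := by
    by_cases hall : ∀ X hX, ρ (SpAux.up X hX) = 1
    · exfalso
      have htop := SpAux.gen (MonoidHom.ker ρ) hall
      have hone : ∀ g, ρ g = 1 := fun g => by
        have : g ∈ MonoidHom.ker ρ := htop ▸ Subgroup.mem_top g
        exact this
      exact hgh (by rw [hone g, hone h])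
    · push Not at hall
      obtain ⟨X, hX, hne⟩ := hall
      refine SpAux.eig_card l hl (ρ (SpAux.up X hX)) hne ?_ ?_
      · rw [← map_pow, SpAux.up_pow X hX l (hX.smul _), ← map_one ρ]
        congr 1
        apply Subtype.ext
        simp [SpAux.up, Matrix.fromBlocks_one]
      · intro a ha hal
        have ha0 : (a : ZMod l) ≠ 0 := by
          rw [Ne, ZMod.natCast_eq_zero_iff]
          exact Nat.not_dvd_of_pos_of_lt ha hal
        obtain ⟨g, hg⟩ := SpAux.up_conj X hX a ha0
        exact ⟨ρ g⁻¹, ρ g, by rw [← map_mul, mul_inv_cancel, map_one],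
          by rw [← map_mul, hg, map_mul, map_pow]⟩
  have : l < 5 * Module.finrank ℂ V := by
    have := hl.two_le
    omega
  have h2 : (l : ℝ) < 5 * (Module.finrank ℂ V : ℝ) := by exact_mod_cast this
  linarith
end

section
/- Let l > 3 be a prime, let n ≥ 2 and N ≥ 1 be integers, let 𝒪 and 𝒪' be the rings of integers of finite extensions of ℚ_l, and let λ be the maximal ideal of 𝒪. If φ: SL_n(𝒪') → GL_N(𝒪) is a nontrivial abstract (not assumed continuous) group homomorphism, then the composite of φ with the reduction map GL_N(𝒪) → GL_N(𝒪/λ) is nontrivial; equivalently, φ^{-1}(ker(GL_N(𝒪) → GL_N(𝒪/λ))) is a proper subgroup of SL_n(𝒪'). -/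
open Matrix

/-- Reduction of `GL (Fin N) O` modulo an ideal `I`, i.e. the homomorphism
`GL_N(O) → GL_N(O/I)` induced by the quotient map. -/
noncomputable def glReduction {O : Type*} [CommRing O] (N : ℕ) (I : Ideal O) :
    GL (Fin N) O →* GL (Fin N) (O ⧸ I) :=
  Matrix.GeneralLinearGroup.map (Ideal.Quotient.mk I)

namespace ReductionAux

open Matrix
open scoped commutatorElement

/-- The integral closure of `ℤ_l` in a finite extension of `ℚ_l` is local. -/
theorem isLocalRing_integralClosure (l : ℕ) [Fact (Nat.Prime l)] (K : Type) [Field K]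
    [Algebra ℚ_[l] K] [FiniteDimensional ℚ_[l] K] [Algebra ℤ_[l] K]
    [IsScalarTower ℤ_[l] ℚ_[l] K] : IsLocalRing ↥(integralClosure ℤ_[l] K) := by
  have key : ∀ x : K, spectralNorm ℚ_[l] K x ≤ 1 → x ∈ integralClosure ℤ_[l] K := by
    intro x hx
    have hint : IsIntegral ℚ_[l] x := Algebra.IsIntegral.isIntegral x
    have hm := minpoly.monic hint
    have hc := (spectralValue_le_one_iff hm).1 hx
    have hl : minpoly ℚ_[l] x ∈ Polynomial.lifts (algebraMap ℤ_[l] ℚ_[l]) := by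
      rw [Polynomial.lifts_iff_coeff_lifts]
      intro n
      exact ⟨⟨_, hc n⟩, rfl⟩
    obtain ⟨q, hq, -, hqm⟩ := Polynomial.lifts_and_natDegree_eq_and_monic hl hm
    refine ⟨q, hqm, ?_⟩
    rw [IsScalarTower.algebraMap_eq ℤ_[l] ℚ_[l] K, ← Polynomial.eval₂_map, hq]
    exact minpoly.aeval _ _
  let V : ValuationSubring K :=
    { (integralClosure ℤ_[l] K).toSubring with
      mem_or_inv_mem' := by
        intro x
        by_cases hx : spectralNorm ℚ_[l] K x ≤ 1
        · exact Or.inl (key x hx)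
        · right
          apply key
          push Not at hx
          have h0 : x ≠ 0 := by
            rintro rfl
            rw [spectralNorm_zero] at hx
            linarith
          have h1 : spectralMulAlgNorm ℚ_[l] K x * spectralMulAlgNorm ℚ_[l] K x⁻¹ = 1 := by
            rw [← map_mul, mul_inv_cancel₀ h0, map_one]
          rw [spectralMulAlgNorm_def, spectralMulAlgNorm_def] at h1
          have h2 : 0 ≤ spectralNorm ℚ_[l] K x⁻¹ := spectralNorm_nonneg _
          nlinarith }
  exact (inferInstance : IsLocalRing V)

section Gen

variable {n : ℕ} {R : Type*} [CommRing R]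

/-- Clearing a column with a pivot equal to `1`. -/
theorem clear_col (H : Subgroup (SpecialLinearGroup (Fin n) R))
    (hH : ∀ (i j : Fin n) (hij : i ≠ j) (c : R), SpecialLinearGroup.transvection hij c ∈ H)
    (g : SpecialLinearGroup (Fin n) R) (k : Fin n) (S : Finset (Fin n)) (hS : k ∉ S) :
    ∃ h ∈ H, ∀ i j, (h * g).1 i j = if i ∈ S then g.1 i j - g.1 i k * g.1 k j else g.1 i j := by
  induction S using Finset.induction_on with
  | empty => exact ⟨1, H.one_mem, by simp⟩
  | insert a S ha ih =>
    have hka : a ≠ k := by rintro rfl; simp at hS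
    obtain ⟨h, hh, h'⟩ := ih (fun h => hS (Finset.mem_insert_of_mem h))
    refine ⟨SpecialLinearGroup.transvection hka (-g.1 a k) * h, H.mul_mem (hH _ _ _ _) hh, ?_⟩
    intro i j
    rw [mul_assoc]
    change (Matrix.transvection a k (-g.1 a k) * (h * g).1) i j = _
    by_cases hi : i = a
    · subst hi
      have hkS : k ∉ S := fun h => hS (Finset.mem_insert_of_mem h)
      rw [transvection_mul_apply_same, h', h', if_neg ha, if_neg hkS,
        if_pos (Finset.mem_insert_self _ _)]
      ring
    · rw [transvection_mul_apply_of_ne _ _ _ _ hi, h']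
      simp [hi]

/-- `g` has its first `k` columns equal to those of the identity. -/
def Good (k : ℕ) (g : SpecialLinearGroup (Fin n) R) : Prop :=
  ∀ i j : Fin n, j.1 < k → g.1 i j = (1 : Matrix (Fin n) (Fin n) R) i j

theorem good_transvection {k : ℕ} {g : SpecialLinearGroup (Fin n) R} (hg : Good k g)
    {a b : Fin n} (hab : a ≠ b) (hb : k ≤ b.1) (c : R) :
    Good k (SpecialLinearGroup.transvection hab c * g) := by
  intro i j hj
  change (Matrix.transvection a b c * g.1) i j = _
  by_cases hi : i = a
  · subst hi
    rw [transvection_mul_apply_same, hg _ _ hj, hg _ _ hj,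
      Matrix.one_apply_ne (show b ≠ j by rintro rfl; omega)]
    ring
  · rw [transvection_mul_apply_of_ne _ _ _ _ hi, hg _ _ hj]

theorem transvection_mem_commutator (h2 : IsUnit (2 : R)) (h3 : IsUnit (3 : R))
    (i j : Fin n) (hij : i ≠ j) (c : R) :
    SpecialLinearGroup.transvection hij c ∈ commutator (SpecialLinearGroup (Fin n) R) := by
  obtain ⟨u, hu⟩ := h2
  obtain ⟨v, hv⟩ := h3
  let d : Fin n → R := Pi.mulSingle i (u : R) * Pi.mulSingle j (↑u⁻¹ : R)
  have hdi : d i = 2 := by simp [d, hij, hu]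
  have hdj : d j * 2 = 1 := by simp [d, hij.symm, ← hu]
  let D : SpecialLinearGroup (Fin n) R := ⟨Matrix.diagonal d, by
    rw [Matrix.det_diagonal]
    simp only [d, Pi.mul_apply, Finset.prod_mul_distrib, Finset.prod_pi_mulSingle',
      Finset.mem_univ, if_true, Units.mul_inv]⟩
  let b : R := c * ↑v⁻¹
  have hb : 3 * b = c := by
    rw [← hv]; simp only [b]; rw [mul_left_comm, Units.mul_inv, mul_one]
  have hcomm : D * SpecialLinearGroup.transvection hij b =
      SpecialLinearGroup.transvection hij (4 * b) * D := by
    apply Subtype.ext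
    change Matrix.diagonal d * Matrix.transvection i j b =
      Matrix.transvection i j (4 * b) * Matrix.diagonal d
    simp only [Matrix.transvection, mul_add, add_mul, mul_one, one_mul]
    congr 1
    ext p q
    rw [Matrix.diagonal_mul, Matrix.mul_diagonal, Matrix.single_apply, Matrix.single_apply]
    split_ifs with h
    · obtain ⟨rfl, rfl⟩ := h
      rw [hdi]
      linear_combination (-2 * b) * hdj
    · simp
  have : SpecialLinearGroup.transvection hij c =
      ⁅D, SpecialLinearGroup.transvection hij b⁆ := by
    rw [commutatorElement_def, hcomm, mul_inv_cancel_right, SpecialLinearGroup.transvection_inv,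
      ← SpecialLinearGroup.transvection_add, ← hb]
    congr 1
    ring
  rw [this]
  exact Subgroup.commutator_mem_commutator (Subgroup.mem_top _) (Subgroup.mem_top _)

variable [IsLocalRing R]

theorem exists_unit {k : Fin n} {g : SpecialLinearGroup (Fin n) R} (hg : Good k.1 g) :
    ∃ i : Fin n, k ≤ i ∧ IsUnit (g.1 i k) := by
  by_contra! hcon
  let π := IsLocalRing.residue R
  let w : Fin n → IsLocalRing.ResidueField R :=
    fun j => if j = k then 1 else if j < k then - π (g.1 j k) else 0
  have hw : w ≠ 0 := fun h => by simpa [w] using congrFun h k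
  have hdet : (g.1.map π).det ≠ 0 := by
    have : π g.1.det = (g.1.map π).det := RingHom.map_det π g.1
    rw [← this, g.2, map_one]
    exact one_ne_zero
  apply hdet
  rw [← Matrix.exists_mulVec_eq_zero_iff]
  refine ⟨w, hw, ?_⟩
  ext i
  have hterm : ∀ j, π (g.1 i j) * w j =
      (if j = k then π (g.1 i k) else 0) - (if j = i then if i < k then π (g.1 i k) else 0 else 0) := by
    intro j
    by_cases hjk : j = k
    · subst hjk
      by_cases hji : j = i <;> simp [w, hji]
    · by_cases hlt : j < k
      · have := hg i j hlt
        by_cases hji : j = i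
        · subst hji
          simp [w, hjk, hlt, this]
        · rw [this, Matrix.one_apply_ne (Ne.symm hji)]
          simp [hjk, hji]
      · by_cases hji : j = i
        · subst hji
          simp [w, hjk, hlt]
        · simp [w, hjk, hlt, hji]
  simp only [Matrix.mulVec, dotProduct, Matrix.map_apply, hterm, Finset.sum_sub_distrib,
    Finset.sum_ite_eq', Finset.mem_univ, if_true, Pi.zero_apply]
  by_cases hik : i < k
  · simp [hik]
  · have h1 := hcon i (not_lt.1 hik)
    have : π (g.1 i k) = 0 := by
      rw [IsLocalRing.residue_eq_zero_iff]
      exact h1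
    simp [hik, this]

theorem exists_good_pivot (H : Subgroup (SpecialLinearGroup (Fin n) R))
    (hH : ∀ (i j : Fin n) (hij : i ≠ j) (c : R), SpecialLinearGroup.transvection hij c ∈ H)
    (k : Fin n) (g : SpecialLinearGroup (Fin n) R) (hg : Good k.1 g) :
    ∃ h ∈ H, Good k.1 (h * g) ∧ (h * g).1 k k = 1 := by
  by_cases hk : k.1 + 1 < n
  · have case1 : ∀ (g : SpecialLinearGroup (Fin n) R), Good k.1 g →
        ∀ i : Fin n, k < i → IsUnit (g.1 i k) →
        ∃ h ∈ H, Good k.1 (h * g) ∧ (h * g).1 k k = 1 := by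
      intro g hg i hi hu
      obtain ⟨u, hu⟩ := hu
      refine ⟨SpecialLinearGroup.transvection hi.ne ((1 - g.1 k k) * ↑u⁻¹), hH _ _ _ _,
        good_transvection hg _ hi.le _, ?_⟩
      change ((Matrix.transvection k i ((1 - g.1 k k) * ↑u⁻¹) * g.1 : Matrix (Fin n) (Fin n) R)) k k = _
      rw [transvection_mul_apply_same, ← hu, mul_assoc, Units.inv_mul]
      ring
    obtain ⟨i, hki, hu⟩ := exists_unit hg
    rcases hki.lt_or_eq with hlt | rfl
    · exact case1 g hg i hlt hu
    · let j : Fin n := ⟨k.1 + 1, hk⟩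
      have hkj : k < j := Nat.lt_succ_self _
      by_cases hj : IsUnit (g.1 j k)
      · exact case1 g hg j hkj hj
      · have hg2 := good_transvection hg hkj.ne' le_rfl 1
        have hu2 : IsUnit ((SpecialLinearGroup.transvection hkj.ne' 1 * g).1 j k) := by
          change IsUnit ((Matrix.transvection j k 1 * g.1 : Matrix (Fin n) (Fin n) R) j k)
          rw [transvection_mul_apply_same, one_mul]
          by_contra hn
          have := IsLocalRing.nonunits_add (a := g.1 j k + g.1 k k) (b := - g.1 j k) hn
            (by simpa using hj)
          rw [add_neg_cancel_comm] at this
          exact this hu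
        obtain ⟨h, hh, h1, h2⟩ := case1 _ hg2 j hkj hu2
        exact ⟨h * SpecialLinearGroup.transvection hkj.ne' 1, H.mul_mem hh (hH _ _ _ _),
          by rwa [mul_assoc], by rwa [mul_assoc]⟩
  · refine ⟨1, H.one_mem, by rwa [one_mul], ?_⟩
    rw [one_mul]
    have htri : g.1.BlockTriangular id := by
      intro i j hij
      have hij' : j < i := hij
      rw [hg i j (by omega), Matrix.one_apply_ne hij'.ne']
    have hd := Matrix.det_of_isUpperTriangular htri
    rw [g.2, Finset.prod_eq_single k] at hd
    · exact hd.symm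
    · intro b _ hb
      rw [hg b b (by omega), Matrix.one_apply_eq]
    · simp

theorem exists_good (H : Subgroup (SpecialLinearGroup (Fin n) R))
    (hH : ∀ (i j : Fin n) (hij : i ≠ j) (c : R), SpecialLinearGroup.transvection hij c ∈ H)
    (g : SpecialLinearGroup (Fin n) R) (k : ℕ) (hk : k ≤ n) : ∃ h ∈ H, Good k (h * g) := by
  induction k with
  | zero => exact ⟨1, H.one_mem, fun i j hj => by omega⟩
  | succ k ih =>
    obtain ⟨h, hh, hg⟩ := ih (by omega)
    let k' : Fin n := ⟨k, hk⟩
    obtain ⟨h2, hh2, hg2, hone⟩ := exists_good_pivot H hH k' _ hg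
    obtain ⟨h3, hh3, hg3⟩ := clear_col H hH (h2 * (h * g)) k' (Finset.univ.erase k') (by simp)
    refine ⟨h3 * h2 * h, H.mul_mem (H.mul_mem hh3 hh2) hh, ?_⟩
    intro i j hj
    rw [mul_assoc, mul_assoc, hg3]
    by_cases hjk : j = k'
    · subst hjk
      by_cases hi : i = k'
      · subst hi
        simp [hone]
      · simp [hone, hi]
    · have hj' : j.1 < k'.1 := by
        have : j.1 ≠ k := fun h => hjk (Fin.ext h)
        change j.1 < k
        omega
      rw [hg2 i j hj', hg2 k' j hj', Matrix.one_apply_ne (Ne.symm hjk)]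
      simp

theorem subgroup_eq_top (H : Subgroup (SpecialLinearGroup (Fin n) R))
    (hH : ∀ (i j : Fin n) (hij : i ≠ j) (c : R), SpecialLinearGroup.transvection hij c ∈ H) :
    H = ⊤ := by
  rw [eq_top_iff]
  intro g _
  obtain ⟨h, hh, hg⟩ := exists_good H hH g n le_rfl
  have : h * g = 1 := Subtype.ext (Matrix.ext fun i j => hg i j j.2)
  rw [eq_inv_of_mul_eq_one_right this]
  exact H.inv_mem hh

theorem commutator_eq_top (h2 : IsUnit (2 : R)) (h3 : IsUnit (3 : R)) :
    commutator (SpecialLinearGroup (Fin n) R) = ⊤ :=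
  subgroup_eq_top _ (transvection_mem_commutator h2 h3)

end Gen

theorem commutator_mod_sq {O : Type*} [CommRing O] {N : ℕ} (I : Ideal O) (A B : GL (Fin N) O)
    (hA : glReduction N I A = 1) (hB : glReduction N I B = 1) :
    glReduction N (I ^ 2) ⁅A, B⁆ = 1 := by
  have key : ∀ A : GL (Fin N) O, glReduction N I A = 1 →
      ∀ i j, (A.1 - 1) i j ∈ I := by
    intro A hA i j
    have := congrArg (fun M : GL (Fin N) (O ⧸ I) => (M : Matrix (Fin N) (Fin N) (O ⧸ I)) i j) hA
    have h1 : Ideal.Quotient.mk I (A.1 i j) = (1 : Matrix (Fin N) (Fin N) (O ⧸ I)) i j := this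
    rw [← Ideal.Quotient.eq_zero_iff_mem, Matrix.sub_apply, map_sub, h1]
    by_cases hij : i = j
    · subst hij; simp
    · simp [hij]
  have hmem : ∀ X Y : Matrix (Fin N) (Fin N) O, (∀ i j, X i j ∈ I) → (∀ i j, Y i j ∈ I) →
      ∀ i j, (X * Y) i j ∈ I ^ 2 := by
    intro X Y hX hY i j
    rw [Matrix.mul_apply, sq]
    exact Ideal.sum_mem _ fun k _ => Ideal.mul_mem_mul (hX i k) (hY k j)
  rw [map_commutatorElement, commutatorElement_eq_one_iff_mul_comm, ← map_mul, ← map_mul]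
  apply Units.ext
  ext i j
  change Ideal.Quotient.mk (I ^ 2) ((A.1 * B.1) i j) = Ideal.Quotient.mk (I ^ 2) ((B.1 * A.1) i j)
  rw [Ideal.Quotient.eq, ← Matrix.sub_apply]
  have : A.1 * B.1 - B.1 * A.1 = (A.1 - 1) * (B.1 - 1) - (B.1 - 1) * (A.1 - 1) := by
    noncomm_ring
  rw [this, Matrix.sub_apply]
  exact Ideal.sub_mem _ (hmem _ _ (key A hA) (key B hB) i j) (hmem _ _ (key B hB) (key A hA) i j)

theorem eq_one_of_perfect {G : Type*} [Group G] (hG : commutator G = ⊤)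
    {O : Type*} [CommRing O] {N : ℕ} (I : Ideal O) (hI : ⨅ i : ℕ, I ^ i = ⊥)
    (φ : G →* GL (Fin N) O) (h : (glReduction N I).comp φ = 1) : φ = 1 := by
  have step : ∀ J : Ideal O, (glReduction N J).comp φ = 1 →
      (glReduction N (J ^ 2)).comp φ = 1 := by
    intro J hJ
    have : commutator G ≤ ((glReduction N (J ^ 2)).comp φ).ker := by
      rw [commutator_def, Subgroup.commutator_le]
      intro a _ b _
      rw [MonoidHom.mem_ker, MonoidHom.comp_apply, map_commutatorElement]
      exact commutator_mod_sq J _ _ (DFunLike.congr_fun hJ a) (DFunLike.congr_fun hJ b)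
    ext1 g
    exact this (hG ▸ Subgroup.mem_top g)
  have all : ∀ k : ℕ, (glReduction N (I ^ (2 ^ k))).comp φ = 1 := by
    intro k
    induction k with
    | zero => rwa [pow_zero, pow_one]
    | succ k ih =>
      rw [pow_succ, pow_mul]
      exact step _ ih
  ext g i j
  rw [← sub_eq_zero, ← Ideal.mem_bot, ← hI, Ideal.mem_iInf]
  intro k
  refine Ideal.pow_le_pow_right (Nat.lt_two_pow_self (n := k)).le ?_
  rw [← Ideal.Quotient.eq]
  have := congrArg (fun M : GL (Fin N) (O ⧸ (I ^ 2 ^ k)) =>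
    (M : Matrix (Fin N) (Fin N) (O ⧸ (I ^ 2 ^ k))) i j) (DFunLike.congr_fun (all k) g)
  refine Eq.trans this ?_
  change (1 : Matrix (Fin N) (Fin N) (O ⧸ (I ^ 2 ^ k))) i j =
    Ideal.Quotient.mk _ ((1 : Matrix (Fin N) (Fin N) O) i j)
  by_cases hij : i = j
  · subst hij; simp
  · simp [hij]

theorem isUnit_natCast (l : ℕ) [Fact (Nat.Prime l)] (m : ℕ) (hm : m ≠ 0) (hml : m < l)
    (A : Type*) [CommRing A] [Algebra ℤ_[l] A] : IsUnit (m : A) := by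
  have h : IsUnit (m : ℤ_[l]) := by
    rw [PadicInt.isUnit_iff, PadicInt.norm_def, PadicInt.coe_natCast,
      Padic.norm_natCast_eq_one_iff]
    exact ((Fact.out : Nat.Prime l).coprime_iff_not_dvd).2
      (fun h => absurd (Nat.le_of_dvd (Nat.pos_of_ne_zero hm) h) (by omega))
  simpa using h.map (algebraMap ℤ_[l] A)

end ReductionAux

/-- **Wong, equation (9) in the proof of Theorem 4(b).**  Let `l > 3` be a prime, `n ≥ 2`,
`N ≥ 1`, and let `𝒪, 𝒪'` be the rings of integers of finite extensions `K, K'` of `ℚ_l`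
(realized as the integral closure of `ℤ_l` in the extension, a local ring with maximal
ideal `λ`).  If `φ : SL_n(𝒪') → GL_N(𝒪)` is a nontrivial abstract (not assumed continuous)
group homomorphism, then the composite of `φ` with the reduction map
`GL_N(𝒪) → GL_N(𝒪/λ)` is nontrivial; equivalently, `φ⁻¹(ker(GL_N(𝒪) → GL_N(𝒪/λ)))` is a
proper subgroup of `SL_n(𝒪')`. -/
theorem reduction_comp_nontrivial
    (l : ℕ) [Fact (Nat.Prime l)] (hl : 3 < l) (n N : ℕ) (hn : 2 ≤ n) (hN : 1 ≤ N)
    (K K' : Type) [Field K] [Field K']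
    [Algebra ℚ_[l] K] [Algebra ℚ_[l] K']
    [FiniteDimensional ℚ_[l] K] [FiniteDimensional ℚ_[l] K']
    [Algebra ℤ_[l] K] [Algebra ℤ_[l] K']
    [IsScalarTower ℤ_[l] ℚ_[l] K] [IsScalarTower ℤ_[l] ℚ_[l] K']
    [IsLocalRing ↥(integralClosure ℤ_[l] K)]
    (φ : Matrix.SpecialLinearGroup (Fin n) ↥(integralClosure ℤ_[l] K') →*
          GL (Fin N) ↥(integralClosure ℤ_[l] K))
    (hφ : φ ≠ 1) :
    (glReduction N (IsLocalRing.maximalIdeal ↥(integralClosure ℤ_[l] K))).comp φ ≠ 1 := by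
  intro h
  have := ReductionAux.isLocalRing_integralClosure l K'
  have : IsNoetherianRing ↥(integralClosure ℤ_[l] K) :=
    integralClosure.isNoetherianRing (A := ℤ_[l]) (K := ℚ_[l]) (L := K)
  apply hφ
  refine ReductionAux.eq_one_of_perfect (ReductionAux.commutator_eq_top ?_ ?_) _
    (Ideal.iInf_pow_eq_bot_of_isLocalRing _ Ideal.IsPrime.ne_top') φ h
  · exact_mod_cast ReductionAux.isUnit_natCast l 2 (by norm_num) (by omega)
      ↥(integralClosure ℤ_[l] K')
  · exact_mod_cast ReductionAux.isUnit_natCast l 3 (by norm_num) hl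
      ↥(integralClosure ℤ_[l] K')
end
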